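/- arXiv:2002.01654 — 2 statements merged into one kernel-verified Lean document; each statement's English description precedes it below -/
import Mathlib

section
/- The angle function b tends to +∞ at +∞: for every K > 0 there exists β₀ > 0 such that b(β) > K for all β ≥ β₀. -/
open Set Filter

/-- `u` is a solution of the ODE `u'' + h u' + λ(|u|^{q-1} u - u) = 0`,
being C¹ on the closed set `S` (with derivative `u'`) and C² on `Sint`
(with second derivative `u''`), where the equation holds on `Sint`. -/
def SolOn (h : ℝ → ℝ) (lam q : ℝ) (S Sint : Set ℝ) (u u' u'' : ℝ → ℝ) : Prop :=
  (∀ t ∈ S, HasDerivWithinAt u (u' t) S t) ∧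
  ContinuousOn u' S ∧
  (∀ t ∈ Sint, HasDerivWithinAt u' (u'' t) Sint t) ∧
  ContinuousOn u'' Sint ∧
  (∀ t ∈ Sint, u'' t + h t * u' t + lam * (|u t| ^ (q - 1) * u t - u t) = 0)

/-- The Euclidean norm on ℝ². -/
noncomputable def enorm2 (p : ℝ × ℝ) : ℝ := Real.sqrt (p.1 ^ 2 + p.2 ^ 2)

/-- The nonlinearity `|x|^{q-1} x - x`. -/
noncomputable def nonlin (q x : ℝ) : ℝ := |x| ^ (q - 1) * x - x

/-- The primitive of `nonlin q` vanishing at `0`. -/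
noncomputable def potential (q x : ℝ) : ℝ := |x| ^ (q + 1) / (q + 1) - x ^ 2 / 2

theorem abs_rpow_add_one {q : ℝ} (hq : 1 < q) (x : ℝ) :
    |x| ^ (q + 1) = |x| ^ (q - 1) * x ^ 2 := by
  rcases eq_or_ne x 0 with rfl | hx
  · simp [Real.zero_rpow (by linarith : q + 1 ≠ 0)]
  · rw [← sq_abs x, ← Real.rpow_natCast |x| 2, ← Real.rpow_add (abs_pos.2 hx)]
    congr 1; push_cast; ring

theorem mul_nonlin {q : ℝ} (hq : 1 < q) (x : ℝ) :
    x * nonlin q x = |x| ^ (q + 1) - x ^ 2 := by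
  rw [abs_rpow_add_one hq, nonlin]; ring

theorem hasDerivAt_potential {q : ℝ} (hq : 1 < q) (x : ℝ) :
    HasDerivAt (potential q) (nonlin q x) x := by
  have h1 := ((hasDerivAt_abs_rpow x (by linarith : 1 < q + 1)).div_const (q + 1)).sub
    (((hasDerivAt_id x).pow 2).div_const 2)
  refine h1.congr_deriv ?_
  have : q + 1 ≠ 0 := by linarith
  rw [nonlin, show q + 1 - 2 = q - 1 by ring]
  simp
  field_simp

theorem hasDerivAt_abs_rpow_mul {q : ℝ} (hq : 1 < q) (x : ℝ) :
    HasDerivAt (fun y => |y| ^ (q - 1) * y) (q * |x| ^ (q - 1)) x := by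
  rcases lt_trichotomy x 0 with hx | rfl | hx
  · have h1 := (((hasDerivAt_id x).neg).rpow_const (p := q) (Or.inr hq.le)).neg
    have h2 : (fun y : ℝ => |y| ^ (q - 1) * y) =ᶠ[nhds x] fun y => -(-y) ^ q := by
      filter_upwards [Iio_mem_nhds hx] with y (hy : y < 0)
      have hy' := hy.ne
      rw [abs_of_neg hy, Real.rpow_sub_one (by linarith)]
      field_simp
    refine (h1.congr_of_eventuallyEq h2).congr_deriv ?_
    simp [abs_of_neg hx]
  · rw [hasDerivAt_iff_tendsto_slope]
    have h0 : Tendsto (fun y : ℝ => |y| ^ (q - 1)) (nhds 0) (nhds 0) := by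
      have := ((continuous_abs (G := ℝ)).rpow_const
        (fun _ => Or.inr (by linarith : 0 ≤ q - 1))).tendsto (0 : ℝ)
      simpa [Real.zero_rpow (by linarith : q - 1 ≠ 0)] using this
    have h1 := h0.mono_left (nhdsWithin_le_nhds (s := {0}ᶜ))
    simp only [abs_zero, Real.zero_rpow (by linarith : q - 1 ≠ 0), mul_zero]
    refine h1.congr' ?_
    filter_upwards [self_mem_nhdsWithin] with y hy
    have : y ≠ 0 := hy
    simp [slope_def_field]
    field_simp
  · have h1 := ((hasDerivAt_id x).rpow_const (p := q) (Or.inr hq.le))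
    have h2 : (fun y : ℝ => |y| ^ (q - 1) * y) =ᶠ[nhds x] fun y => y ^ q := by
      filter_upwards [Ioi_mem_nhds hx] with y (hy : 0 < y)
      rw [abs_of_pos hy, Real.rpow_sub_one (by linarith)]
      field_simp
    refine (h1.congr_of_eventuallyEq h2).congr_deriv ?_
    simp [abs_of_pos hx]

theorem nonlin_lipschitz {q : ℝ} (hq : 1 < q) (M : ℝ) :
    ∃ L, 0 ≤ L ∧ ∀ x y, |x| ≤ M → |y| ≤ M → |nonlin q x - nonlin q y| ≤ L * |x - y| := by
  refine ⟨q * |M| ^ (q - 1) + 1, by positivity, fun x y hx hy => ?_⟩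
  have hd : ∀ z ∈ Icc (-M) M,
      HasDerivWithinAt (nonlin q) (q * |z| ^ (q - 1) - 1) (Icc (-M) M) z := fun z _ =>
    ((hasDerivAt_abs_rpow_mul hq z).sub (hasDerivAt_id z)).hasDerivWithinAt
  have := (convex_Icc (-M) M).norm_image_sub_le_of_norm_hasDerivWithin_le (C := q * |M| ^ (q - 1) + 1)
    hd (fun z hz => ?_) (abs_le.1 hy) (abs_le.1 hx)
  · simpa using this
  · have h1 : |z| ^ (q - 1) ≤ |M| ^ (q - 1) :=
      Real.rpow_le_rpow (abs_nonneg _) ((abs_le.2 hz).trans (le_abs_self M)) (by linarith)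
    have h2 : 0 ≤ |z| ^ (q - 1) := by positivity
    rw [Real.norm_eq_abs, abs_le]
    constructor <;> nlinarith

theorem exists_mul_sq_le_abs_rpow {q : ℝ} (hq : 1 < q) (A : ℝ) :
    ∃ C, 0 ≤ C ∧ ∀ x : ℝ, A * x ^ 2 ≤ |x| ^ (q + 1) + C := by
  refine ⟨|A| * (|A| ^ (1 / (q - 1))) ^ 2, by positivity, fun x => ?_⟩
  have h0 : 0 ≤ |x| ^ (q + 1) := by positivity
  have hq' : q - 1 ≠ 0 := by linarith
  rcases le_total |x| (|A| ^ (1 / (q - 1))) with hx | hx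
  · have : x ^ 2 ≤ (|A| ^ (1 / (q - 1))) ^ 2 := by rw [← sq_abs x]; gcongr
    nlinarith [le_abs_self A, sq_nonneg x, abs_nonneg A]
  · have h1 : |A| ≤ |x| ^ (q - 1) := by
      have := Real.rpow_le_rpow (by positivity) hx (by linarith : 0 ≤ q - 1)
      rwa [← Real.rpow_mul (abs_nonneg _), one_div, inv_mul_cancel₀ hq', Real.rpow_one] at this
    rw [abs_rpow_add_one hq]
    have : 0 ≤ |A| * (|A| ^ (1 / (q - 1))) ^ 2 := by positivity
    nlinarith [le_abs_self A, sq_nonneg x]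

theorem exists_potential_lower_bound {q : ℝ} (hq : 1 < q) :
    ∃ C, 0 ≤ C ∧ ∀ x, x ^ 2 / 2 - C ≤ potential q x := by
  obtain ⟨C, hC, h⟩ := exists_mul_sq_le_abs_rpow hq (q + 1)
  refine ⟨C / (q + 1), by positivity, fun x => ?_⟩
  have h1 : x ^ 2 ≤ (|x| ^ (q + 1) + C) / (q + 1) := by
    rw [le_div_iff₀ (by linarith)]; linarith [h x]
  rw [add_div] at h1
  rw [potential]; linarith

/-- `v` solves `v'' + g v' + λ (|v|^{q-1} v - v) = 0` on `(0, T)`, with derivative `w`, initial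
value `v(0) = β` and `v'(0) = 0`. -/
structure RadialSol (g : ℝ → ℝ) (lam q T β : ℝ) (v w : ℝ → ℝ) : Prop where
  contV : ContinuousOn v (Icc 0 T)
  contW : ContinuousOn w (Icc 0 T)
  derivV : ∀ s ∈ Ioo 0 T, HasDerivAt v (w s) s
  derivW : ∀ s ∈ Ioo 0 T, HasDerivAt w (-(g s * w s) - lam * nonlin q (v s)) s
  initV : v 0 = β
  initW : w 0 = 0

/-- The energy of the state `(v, v') = (x, y)`. -/
noncomputable def energy (lam q x y : ℝ) : ℝ := y ^ 2 / 2 + lam * potential q x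

theorem exists_energy_lower_bound {lam q : ℝ} (hlam : 0 < lam) (hq : 1 < q) :
    ∃ C, 0 ≤ C ∧ ∀ x y, y ^ 2 / 2 + lam * x ^ 2 / 2 ≤ energy lam q x y + C := by
  obtain ⟨C, hC, h⟩ := exists_potential_lower_bound hq
  refine ⟨lam * C, by positivity, fun x y => ?_⟩
  rw [energy]
  nlinarith [h x]

theorem potential_le_rpow {q : ℝ} (hq : 1 < q) (x : ℝ) : potential q x ≤ |x| ^ (q + 1) := by
  have h0 : 0 ≤ |x| ^ (q + 1) := by positivity
  have : |x| ^ (q + 1) / (q + 1) ≤ |x| ^ (q + 1) := div_le_self h0 (by linarith)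
  rw [potential]; nlinarith [sq_nonneg x]

namespace RadialSol

variable {g : ℝ → ℝ} {lam q T β : ℝ} {v w : ℝ → ℝ}

theorem continuousOn_energy (hs : RadialSol g lam q T β v w) (hq : 1 < q) :
    ContinuousOn (fun s => energy lam q (v s) (w s)) (Icc 0 T) := by
  have hp : Continuous (potential q) :=
    continuous_iff_continuousAt.2 fun x => (hasDerivAt_potential hq x).continuousAt
  exact ((hs.contW.pow 2).div_const 2).add (continuousOn_const.mul (hp.comp_continuousOn hs.contV))

theorem hasDerivAt_energy (hs : RadialSol g lam q T β v w) (hq : 1 < q) {s : ℝ}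
    (h : s ∈ Ioo 0 T) :
    HasDerivAt (fun s => energy lam q (v s) (w s)) (-(g s * w s ^ 2)) s := by
  have h1 := (((hs.derivW s h).pow 2).div_const 2).add
    (((hasDerivAt_potential hq (v s)).comp s (hs.derivV s h)).const_mul lam)
  refine h1.congr_deriv ?_
  simp; ring

theorem energy_antitoneOn (hs : RadialSol g lam q T β v w) (hq : 1 < q)
    (hg : ∀ s ∈ Ioo 0 T, 0 < g s) :
    AntitoneOn (fun s => energy lam q (v s) (w s)) (Icc 0 T) := by
  refine antitoneOn_of_hasDerivWithinAt_nonpos (f' := fun s => -(g s * w s ^ 2))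
    (convex_Icc 0 T) (hs.continuousOn_energy hq)
    (fun s h => ?_) (fun s h => ?_) <;> rw [interior_Icc] at h
  · exact (hs.hasDerivAt_energy hq h).hasDerivWithinAt
  · have := hg s h
    simp only [neg_nonpos]; positivity

theorem energy_le (hs : RadialSol g lam q T β v w) (hlam : 0 < lam) (hq : 1 < q)
    (hg : ∀ s ∈ Ioo 0 T, 0 < g s) {s : ℝ} (h : s ∈ Icc 0 T) :
    energy lam q (v s) (w s) ≤ lam * |β| ^ (q + 1) := by
  have := hs.energy_antitoneOn hq hg ⟨le_rfl, h.1.trans h.2⟩ h h.1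
  refine this.trans ?_
  simp only [hs.initV, hs.initW, energy]
  nlinarith [potential_le_rpow hq β]

/-- The squared distance in phase space grows at most exponentially wherever the damping term
is bounded below. -/
theorem hasDerivAt_sq_dist {β' : ℝ} {v' w' : ℝ → ℝ} (hs : RadialSol g lam q T β v w)
    (hs' : RadialSol g lam q T β' v' w') {s : ℝ} (h : s ∈ Ioo 0 T) :
    HasDerivAt (fun s => (v s - v' s) ^ 2 + (w s - w' s) ^ 2)
      (2 * (v s - v' s) * (w s - w' s) - 2 * g s * (w s - w' s) ^ 2
        - 2 * lam * (w s - w' s) * (nonlin q (v s) - nonlin q (v' s))) s := by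
  have h1 := (((hs.derivV s h).sub (hs'.derivV s h)).pow 2).add
    (((hs.derivW s h).sub (hs'.derivW s h)).pow 2)
  refine h1.congr_deriv ?_
  simp; ring

theorem bounded (hlam : 0 < lam) (hq : 1 < q) (hg : ∀ s ∈ Ioo 0 T, 0 < g s) (B : ℝ) :
    ∃ M, ∀ β v w, |β| ≤ B → RadialSol g lam q T β v w → ∀ s ∈ Icc 0 T, |v s| ≤ M := by
  obtain ⟨C, hC, h⟩ := exists_energy_lower_bound hlam hq
  refine ⟨√(2 / lam * (lam * B ^ (q + 1) + C)), fun β v w hβ hs s h' => Real.abs_le_sqrt ?_⟩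
  have h1 := hs.energy_le hlam hq hg h'
  have h2 : |β| ^ (q + 1) ≤ B ^ (q + 1) :=
    Real.rpow_le_rpow (abs_nonneg _) hβ (by linarith)
  have h3 := h (v s) (w s)
  rw [div_mul_eq_mul_div, le_div_iff₀ hlam]
  nlinarith [sq_nonneg (w s)]

theorem dependence (hlam : 0 < lam) (hq : 1 < q) (hg : ∀ s ∈ Ioo 0 T, 0 < g s) (B : ℝ) :
    ∃ C, 0 ≤ C ∧ ∀ β v w β' v' w', |β| ≤ B → |β'| ≤ B → RadialSol g lam q T β v w →
      RadialSol g lam q T β' v' w' → ∀ s ∈ Icc 0 T,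
      (v s - v' s) ^ 2 + (w s - w' s) ^ 2 ≤ C * (β - β') ^ 2 := by
  obtain ⟨M, hM⟩ := bounded (lam := lam) (q := q) (T := T) (g := g) hlam hq hg B
  obtain ⟨L, hL, hlip⟩ := nonlin_lipschitz hq M
  set k := 1 + lam * L with hk
  refine ⟨Real.exp (k * T), (Real.exp_pos _).le, fun β v w β' v' w' hβ hβ' hs hs' s h => ?_⟩
  set D := fun s => (v s - v' s) ^ 2 + (w s - w' s) ^ 2 with hD
  have hanti : AntitoneOn (fun s => Real.exp (-k * s) * D s) (Icc 0 T) := by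
    refine antitoneOn_of_hasDerivWithinAt_nonpos (convex_Icc 0 T) ?_
      (fun s h => by
        rw [interior_Icc] at h
        exact ((((hasDerivAt_id s).const_mul (-k)).exp).mul
          (hs.hasDerivAt_sq_dist hs' h)).hasDerivWithinAt) (fun s h => ?_)
    · exact (Continuous.continuousOn (by fun_prop)).mul
        (((hs.contV.sub hs'.contV).pow 2).add ((hs.contW.sub hs'.contW).pow 2))
    · rw [interior_Icc] at h
      have h1 := hlip _ _ (hM _ _ _ hβ hs s (Ioo_subset_Icc_self h))
        (hM _ _ _ hβ' hs' s (Ioo_subset_Icc_self h))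
      have h2 := hg s h
      set a := v s - v' s
      set b := w s - w' s
      have h3 : 2 * a * b ≤ a ^ 2 + b ^ 2 := two_mul_le_add_sq a b
      have h4 : -(2 * lam * b * (nonlin q (v s) - nonlin q (v' s))) ≤
          lam * L * (a ^ 2 + b ^ 2) := by
        have h5 : -(b * (nonlin q (v s) - nonlin q (v' s))) ≤ |b| * (L * |a|) :=
          (neg_le_abs _).trans (by rw [abs_mul]; gcongr)
        have h6 : 2 * (|b| * |a|) ≤ a ^ 2 + b ^ 2 := by
          rw [← sq_abs a, ← sq_abs b]; nlinarith [sq_nonneg (|a| - |b|)]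
        nlinarith [mul_le_mul_of_nonneg_left h6 (mul_nonneg hlam.le hL),
          mul_le_mul_of_nonneg_left h5 hlam.le]
      have h7 : 0 ≤ 2 * g s * b ^ 2 := by positivity
      have h8 : 2 * a * b - 2 * g s * b ^ 2 - 2 * lam * b * (nonlin q (v s) - nonlin q (v' s))
          ≤ k * (a ^ 2 + b ^ 2) := by rw [hk]; linarith
      have h9 := mul_le_mul_of_nonneg_left h8 (Real.exp_pos (-k * s)).le
      simp only [id, mul_one]
      linarith
  have h1 := hanti ⟨le_rfl, h.1.trans h.2⟩ h h.1
  simp only [hD, hs.initV, hs'.initV, hs.initW, hs'.initW, mul_zero, Real.exp_zero, one_mul,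
    sub_zero, ne_eq, OfNat.ofNat_ne_zero, not_false_eq_true, zero_pow, add_zero] at h1
  have h2 : (v s - v' s) ^ 2 + (w s - w' s) ^ 2 ≤ Real.exp (k * s) * (β - β') ^ 2 := by
    have h3 := mul_le_mul_of_nonneg_left h1 (Real.exp_pos (k * s)).le
    rwa [← mul_assoc, ← Real.exp_add, neg_mul, add_neg_cancel, Real.exp_zero, one_mul] at h3
  refine h2.trans ?_
  have : 0 ≤ k := by positivity
  have h3 := h.2
  gcongr

theorem ne_zero (hs : RadialSol g lam q T β v w) (hlam : 0 < lam) (hq : 1 < q)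
    (hg : ∀ s ∈ Ioo 0 T, 0 < g s) (hgb : ∀ δ ∈ Ioo 0 T, ∃ G, ∀ s ∈ Ioo δ T, g s ≤ G)
    (hβ : β ≠ 0) {s : ℝ} (h : s ∈ Icc 0 T) : v s ^ 2 + w s ^ 2 ≠ 0 := by
  intro h0
  obtain ⟨M, hM⟩ := bounded (lam := lam) (q := q) (T := T) (g := g) hlam hq hg |β|
  have hM0 : 0 ≤ M := (abs_nonneg _).trans (hM _ _ _ le_rfl hs s h)
  obtain ⟨L, hL, hlip⟩ := nonlin_lipschitz hq M
  have hs0 : s ≠ 0 := by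
    rintro rfl
    rw [hs.initV, hs.initW] at h0
    simp [hβ] at h0
  have hspos : 0 < s := lt_of_le_of_ne h.1 hs0.symm
  have hv : ∀ r ∈ Ioo 0 s, v r = 0 := by
    intro r hr
    obtain ⟨G, hG⟩ := hgb r ⟨hr.1, hr.2.trans_le h.2⟩
    set k := 1 + 2 * |G| + lam * L with hk
    have hsub : Icc r s ⊆ Icc 0 T := Icc_subset_Icc hr.1.le h.2
    have hmono : MonotoneOn (fun s => Real.exp (k * s) * (v s ^ 2 + w s ^ 2)) (Icc r s) := by
      refine monotoneOn_of_hasDerivWithinAt_nonneg (convex_Icc r s) ?_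
        (fun x hx => by
          rw [interior_Icc] at hx
          have hx' : x ∈ Ioo 0 T := ⟨hr.1.trans hx.1, hx.2.trans_le h.2⟩
          exact ((((hasDerivAt_id x).const_mul k).exp).mul
            (((hs.derivV x hx').pow 2).add ((hs.derivW x hx').pow 2))).hasDerivWithinAt)
        (fun x hx => ?_)
      · exact (Continuous.continuousOn (by fun_prop)).mul
          (((hs.contV.mono hsub).pow 2).add ((hs.contW.mono hsub).pow 2))
      · rw [interior_Icc] at hx
        have hx' : x ∈ Ioo 0 T := ⟨hr.1.trans hx.1, hx.2.trans_le h.2⟩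
        have h1 := hlip (v x) 0 (hM _ _ _ le_rfl hs x (Ioo_subset_Icc_self hx')) (by simpa)
        have h2 := (hG x ⟨hx.1, hx'.2⟩).trans (le_abs_self G)
        have h2' := hg x hx'
        simp only [nonlin, mul_zero, sub_zero] at h1
        set a := v x
        set b := w x
        have h3 : -(a ^ 2 + b ^ 2) ≤ 2 * a * b := by nlinarith [sq_nonneg (a + b)]
        have h4 : (2 * lam * b * nonlin q a) ≤ lam * L * (a ^ 2 + b ^ 2) := by
          have h5 : (b * nonlin q a) ≤ |b| * (L * |a|) :=
            (le_abs_self _).trans (by rw [abs_mul]; gcongr; exact h1)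
          have h6 : 2 * (|b| * |a|) ≤ a ^ 2 + b ^ 2 := by
            rw [← sq_abs a, ← sq_abs b]; nlinarith [sq_nonneg (|a| - |b|)]
          nlinarith [mul_le_mul_of_nonneg_left h6 (mul_nonneg hlam.le hL),
            mul_le_mul_of_nonneg_left h5 hlam.le]
        have h7 : 2 * g x * b ^ 2 ≤ 2 * |G| * (a ^ 2 + b ^ 2) := by
          nlinarith [mul_le_mul_of_nonneg_right h2 (sq_nonneg b),
            mul_nonneg (abs_nonneg G) (sq_nonneg a)]
        have h8 : 0 ≤ k * (a ^ 2 + b ^ 2) + (2 * a * b - 2 * g x * b ^ 2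
            - 2 * lam * b * nonlin q a) := by rw [hk]; linarith
        have h9 := mul_nonneg (Real.exp_pos (k * x)).le h8
        simp
        linarith
    have h1 := hmono ⟨le_rfl, hr.2.le⟩ ⟨hr.2.le, le_rfl⟩ hr.2.le
    simp only [h0, mul_zero] at h1
    have h2 := Real.exp_pos (k * r)
    have h3 : v r ^ 2 + w r ^ 2 ≤ 0 := by
      by_contra! h4
      nlinarith [mul_pos h2 h4]
    have : v r ^ 2 = 0 := by nlinarith [sq_nonneg (v r), sq_nonneg (w r)]
    simpa using this
  have ht : Tendsto v (nhdsWithin 0 (Ioo 0 s)) (nhds β) := by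
    have := hs.contV 0 ⟨le_rfl, hspos.le.trans h.2⟩
    rw [ContinuousWithinAt, hs.initV] at this
    exact this.mono_left (nhdsWithin_mono _ fun x hx => ⟨hx.1.le, hx.2.le.trans h.2⟩)
  have ht' : Tendsto v (nhdsWithin 0 (Ioo 0 s)) (nhds 0) :=
    tendsto_const_nhds.congr' (by
      filter_upwards [self_mem_nhdsWithin] with r hr using (hv r hr).symm)
  have : (nhdsWithin (0 : ℝ) (Ioo 0 s)).NeBot := left_nhdsWithin_Ioo_neBot hspos
  exact hβ (tendsto_nhds_unique ht ht')

end RadialSol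

theorem exists_antiderivative_weight {g : ℝ → ℝ} {T δ p : ℝ} (hgc : ContinuousOn g (Ioo 0 T))
    (hg : ∀ s ∈ Ioo 0 T, 0 < g s) (hδ : δ ∈ Ioo 0 T) (hδ1 : δ ≤ 1)
    (hp : ∀ s ∈ Ioc 0 δ, s * g s ≤ p) :
    ∃ α : ℝ → ℝ, ∀ s ∈ Ioc 0 δ, HasDerivAt α (g s * α s) s ∧ 0 < α s ∧ α s ≤ 1 ∧ s ^ p ≤ α s := by
  set α : ℝ → ℝ := fun s => Real.exp (∫ r in δ..s, g r) with hα
  have hsub : Ioc 0 δ ⊆ Ioo 0 T := fun s hs => ⟨hs.1, hs.2.trans_lt hδ.2⟩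
  have hder : ∀ s ∈ Ioc 0 δ, HasDerivAt α (g s * α s) s := by
    intro s hs
    have hI : HasDerivAt (fun s => ∫ r in δ..s, g r) (g s) s := by
      refine intervalIntegral.integral_hasDerivAt_right ?_ ?_ ?_
      · refine (hgc.mono fun r hr => ?_).intervalIntegrable
        rw [uIcc_of_ge hs.2] at hr
        exact hsub ⟨hs.1.trans_le hr.1, hr.2⟩
      · exact hgc.stronglyMeasurableAtFilter isOpen_Ioo s (hsub hs)
      · exact hgc.continuousAt (isOpen_Ioo.mem_nhds (hsub hs))
    exact hI.exp.congr_deriv (mul_comm _ _)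
  have hpos : ∀ s, 0 < α s := fun s => Real.exp_pos _
  have hone : α δ = 1 := by simp [hα]
  have hp0 : 0 < p := (mul_pos hδ.1 (hg δ hδ)).trans_le (hp δ ⟨hδ.1, le_rfl⟩)
  have hint : interior (Ioc 0 δ) ⊆ Ioc 0 δ := interior_subset
  have hmono : MonotoneOn α (Ioc 0 δ) :=
    monotoneOn_of_hasDerivWithinAt_nonneg (convex_Ioc 0 δ)
      (fun s hs => (hder s hs).continuousAt.continuousWithinAt)
      (fun s hs => (hder s (hint hs)).hasDerivWithinAt)
      (fun s hs => mul_nonneg (hg s (hsub (hint hs))).le (hpos s).le)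
  have hder' : ∀ s ∈ Ioc 0 δ, HasDerivAt (fun s => α s * s ^ (-p))
      (g s * α s * s ^ (-p) + α s * (-p * s ^ (-p - 1))) s := fun s hs =>
    (hder s hs).mul (Real.hasDerivAt_rpow_const (Or.inl hs.1.ne'))
  have hanti : AntitoneOn (fun s => α s * s ^ (-p)) (Ioc 0 δ) := by
    refine antitoneOn_of_hasDerivWithinAt_nonpos (convex_Ioc 0 δ)
      (fun s hs => (hder' s hs).continuousAt.continuousWithinAt)
      (fun s hs => (hder' s (hint hs)).hasDerivWithinAt) (fun s hs => ?_)
    have hs' := hint hs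
    have h1 : s ^ (-p) = s ^ (-p - 1) * s := by
      rw [← Real.rpow_add_one hs'.1.ne']; ring_nf
    rw [h1]
    have h2 : 0 ≤ α s * s ^ (-p - 1) := mul_nonneg (hpos s).le (Real.rpow_nonneg hs'.1.le _)
    nlinarith [hp s hs']
  refine ⟨α, fun s hs => ⟨hder s hs, hpos s, ?_, ?_⟩⟩
  · exact hone ▸ hmono hs ⟨hδ.1, le_rfl⟩ hs.2
  · have h1 := hanti hs ⟨hδ.1, le_rfl⟩ hs.2
    simp only [hone, one_mul] at h1
    have h2 : 1 ≤ δ ^ (-p) := Real.one_le_rpow_of_pos_of_le_one_of_nonpos hδ.1 hδ1 (by linarith)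
    have h3 := h2.trans h1
    rwa [Real.rpow_neg hs.1.le, ← div_eq_mul_inv, le_div_iff₀ (Real.rpow_pos_of_pos hs.1 _),
      one_mul] at h3

/-- The Pohozaev functional with weight `α` and multiplier `μ`. -/
noncomputable def pohozaev (lam q μ : ℝ) (α v w : ℝ → ℝ) (s : ℝ) : ℝ :=
  s * α s * energy lam q (v s) (w s) + μ * α s * (v s * w s)

namespace RadialSol

variable {g : ℝ → ℝ} {lam q T β : ℝ} {v w : ℝ → ℝ}

theorem hasDerivAt_pohozaev (hs : RadialSol g lam q T β v w) (hq : 1 < q) {μ s : ℝ} {α : ℝ → ℝ}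
    (h : s ∈ Ioo 0 T) (hα : HasDerivAt α (g s * α s) s) :
    HasDerivAt (pohozaev lam q μ α v w)
      (α s * ((μ + (1 - s * g s) / 2) * w s ^ 2 +
        lam * ((1 + s * g s) * potential q (v s) - μ * (v s * nonlin q (v s))))) s := by
  have h1 := (((hasDerivAt_id s).mul hα).mul (hs.hasDerivAt_energy hq h)).add
    ((hα.const_mul μ).mul ((hs.derivV s h).mul (hs.derivW s h)))
  refine h1.congr_deriv ?_
  simp [energy]; ring

theorem half_le_of_le (hlam : 0 < lam) (hq : 1 < q) (hg : ∀ s ∈ Ioo 0 T, 0 < g s) :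
    ∃ c, 0 < c ∧ ∀ β v w, 1 ≤ β → RadialSol g lam q T β v w → ∀ s ∈ Icc 0 T,
      s ≤ c * β ^ (-((q - 1) / 2)) → β / 2 ≤ v s := by
  obtain ⟨C, hC, hlow⟩ := exists_energy_lower_bound hlam hq
  set A := √(2 * (lam + C)) with hA
  have hApos : 0 < A := Real.sqrt_pos.2 (by positivity)
  refine ⟨1 / (2 * A), by positivity, fun β v w hβ hs s h hsc => ?_⟩
  have hβ0 : 0 < β := by linarith
  have hw : ∀ r ∈ Icc 0 T, |w r| ≤ A * β ^ ((q + 1) / 2) := by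
    intro r hr
    have h1 := (hs.energy_le hlam hq hg hr)
    have h2 := hlow (v r) (w r)
    rw [abs_of_pos hβ0] at h1
    have h3 : 1 ≤ β ^ (q + 1) := Real.one_le_rpow hβ (by linarith)
    refine abs_le_of_sq_le_sq ?_ (by positivity)
    rw [mul_pow, hA, Real.sq_sqrt (by positivity), ← Real.rpow_mul_natCast hβ0.le]
    rw [show (q + 1) / 2 * ((2 : ℕ) : ℝ) = q + 1 by push_cast; ring]
    nlinarith [mul_nonneg hlam.le (sq_nonneg (v r)), mul_nonneg hC (sub_nonneg.2 h3)]
  have hmono : MonotoneOn (fun r => v r + A * β ^ ((q + 1) / 2) * r) (Icc 0 T) := by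
    refine monotoneOn_of_hasDerivWithinAt_nonneg (convex_Icc 0 T)
      (hs.contV.add (Continuous.continuousOn (by fun_prop))) (fun r hr => ?_) (fun r hr => ?_)
      (f' := fun r => w r + A * β ^ ((q + 1) / 2)) <;> rw [interior_Icc] at hr
    · exact (((hs.derivV r hr).add ((hasDerivAt_id r).const_mul
        (A * β ^ ((q + 1) / 2)))).congr_deriv (by simp)).hasDerivWithinAt
    · have := (abs_le.1 (hw r (Ioo_subset_Icc_self hr))).1
      linarith
  have h1 := hmono ⟨le_rfl, h.1.trans h.2⟩ h h.1
  simp only [hs.initV, mul_zero, add_zero] at h1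
  have h2 : A * β ^ ((q + 1) / 2) * s ≤ β / 2 := by
    calc A * β ^ ((q + 1) / 2) * s
        ≤ A * β ^ ((q + 1) / 2) * (1 / (2 * A) * β ^ (-((q - 1) / 2))) := by gcongr
      _ = (β ^ ((q + 1) / 2) * β ^ (-((q - 1) / 2))) / 2 := by field_simp
      _ = β / 2 := by
        rw [← Real.rpow_add hβ0]
        rw [show (q + 1) / 2 + -((q - 1) / 2) = 1 by ring, Real.rpow_one]
  linarith

/-- A lower bound for the derivative of the Pohozaev functional near the singularity. -/
theorem exists_pohozaev_deriv_bound {k μ ε c : ℝ} (hlam : 0 < lam) (hq : 1 < q) (hc : 0 < c)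
    (hμ : 0 < μ) (hε : ε ≤ 1) (h1 : ε ≤ 2 * μ - (k - 1))
    (h2 : 2 * c ≤ (k + 1 - ε) / (q + 1) - μ) :
    ∃ C, 0 ≤ C ∧ ∀ a x y z : ℝ, 0 ≤ a → a ≤ 1 → |x - k| ≤ ε →
      a * (lam * c * |z| ^ (q + 1) - C) ≤ a * ((μ + (1 - x) / 2) * y ^ 2 +
        lam * ((1 + x) * potential q z - μ * (z * nonlin q z))) := by
  obtain ⟨C, hC, hsq⟩ := exists_mul_sq_le_abs_rpow hq ((k + 2) / (2 * c))
  refine ⟨lam * (c * C), by positivity, fun a x y z ha0 ha1 hx => ?_⟩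
  obtain ⟨hx1, hx2⟩ := abs_le.1 hx
  refine mul_le_mul_of_nonneg_left ?_ ha0
  rw [mul_nonlin hq, potential]
  set R := |z| ^ (q + 1) with hR
  have hR0 : 0 ≤ R := by positivity
  have h3 := hsq z
  have h4 : (k + 2) / 2 * z ^ 2 ≤ c * (R + C) := by
    have := mul_le_mul_of_nonneg_left h3 hc.le
    calc (k + 2) / 2 * z ^ 2 = c * ((k + 2) / (2 * c) * z ^ 2) := by field_simp
      _ ≤ _ := this
  have h5 : (k + 1 - ε) / (q + 1) ≤ (1 + x) / (q + 1) := by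
    gcongr
    linarith
  have h6 : 0 ≤ (μ + (1 - x) / 2) * y ^ 2 := mul_nonneg (by linarith) (sq_nonneg _)
  have h7 : c * R - c * C ≤ (1 + x) * (R / (q + 1) - z ^ 2 / 2) - μ * (R - z ^ 2) := by
    have e : (1 + x) * (R / (q + 1) - z ^ 2 / 2) - μ * (R - z ^ 2) =
      ((1 + x) / (q + 1) - μ) * R - ((1 + x) / 2 - μ) * z ^ 2 := by ring
    rw [e]
    have h8 : 2 * c * R ≤ ((1 + x) / (q + 1) - μ) * R :=
      mul_le_mul_of_nonneg_right (by linarith) hR0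
    have h9 : ((1 + x) / 2 - μ) * z ^ 2 ≤ (k + 2) / 2 * z ^ 2 :=
      mul_le_mul_of_nonneg_right (by linarith) (sq_nonneg z)
    linarith
  have h8 := mul_le_mul_of_nonneg_left h7 hlam.le
  linarith

theorem pohozaev_lower_bound (hs : RadialSol g lam q T β v w) (hq : 1 < q) {μ δ p C D s₁ : ℝ}
    (hμ : 0 < μ) (hD : 0 < D)
    {α : ℝ → ℝ} (hδ : δ ∈ Ioo 0 T) (hC : 0 ≤ C) (hs₁ : s₁ ∈ Ioc 0 δ) (hp : 0 < p)
    (hα : ∀ s ∈ Ioc 0 δ, HasDerivAt α (g s * α s) s ∧ 0 < α s ∧ α s ≤ 1 ∧ s ^ p ≤ α s)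
    (hder : ∀ s ∈ Ioc 0 δ, α s * (D * |v s| ^ (q + 1) - C) ≤
      α s * ((μ + (1 - s * g s) / 2) * w s ^ 2 +
        lam * ((1 + s * g s) * potential q (v s) - μ * (v s * nonlin q (v s)))))
    (hβ : 0 < β) (hv : ∀ s ∈ Ioc 0 s₁, β / 2 ≤ v s) (hβC : 2 * C ≤ D * (β / 2) ^ (q + 1)) :
    (s₁ / 2) ^ (p + 1) * (D * (β / 2) ^ (q + 1) / 2) - C * δ ≤ pohozaev lam q μ α v w δ := by
  have hsub : Ioc 0 δ ⊆ Ioo 0 T := fun s hs => ⟨hs.1, hs.2.trans_lt hδ.2⟩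
  set Q := pohozaev lam q μ α v w with hQ
  have hQd : ∀ s ∈ Ioc 0 δ, HasDerivAt Q _ s := fun s h =>
    hs.hasDerivAt_pohozaev hq (μ := μ) (hsub h) (hα s h).1
  have hmono : MonotoneOn (fun s => Q s + C * s) (Ioc 0 δ) := by
    have hd := fun s h => (hQd s h).add ((hasDerivAt_id s).const_mul C)
    refine monotoneOn_of_hasDerivWithinAt_nonneg (convex_Ioc 0 δ)
      (fun s h => (hd s h).continuousAt.continuousWithinAt)
      (fun s h => (hd s (interior_subset h)).hasDerivWithinAt) (fun s h => ?_)
    have h' := interior_subset h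
    have h1 := hder s h'
    obtain ⟨-, h2, h3, -⟩ := hα s h'
    have h4 : 0 ≤ α s * (D * |v s| ^ (q + 1)) := by positivity
    nlinarith
  have hzero : ∀ s ∈ Ioc 0 δ, 0 ≤ Q s + C * s := by
    intro s h
    have hE : Tendsto (fun r => -(r * |energy lam q (v r) (w r)| + μ * |v r * w r|))
        (nhdsWithin 0 (Ioo 0 s)) (nhds 0) := by
      have hc : ContinuousOn (fun r => -(r * |energy lam q (v r) (w r)| + μ * |v r * w r|))
          (Icc 0 T) :=
        ((continuousOn_id.mul (hs.continuousOn_energy hq).abs).add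
          (continuousOn_const.mul (hs.contV.mul hs.contW).abs)).neg
      have h0 := hc 0 ⟨le_rfl, (hδ.1.trans hδ.2).le⟩
      rw [ContinuousWithinAt] at h0
      simp only [hs.initW, zero_mul, mul_zero, abs_zero, add_zero, neg_zero] at h0
      exact h0.mono_left (nhdsWithin_mono _ fun x hx => ⟨hx.1.le, (hx.2.trans (hsub h).2).le⟩)
    have : (nhdsWithin (0 : ℝ) (Ioo 0 s)).NeBot := left_nhdsWithin_Ioo_neBot h.1
    refine le_of_tendsto hE ?_
    filter_upwards [self_mem_nhdsWithin] with r hr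
    have hr' : r ∈ Ioc 0 δ := ⟨hr.1, hr.2.le.trans h.2⟩
    refine le_trans ?_ (hmono hr' h hr.2.le)
    obtain ⟨-, h2, h3, -⟩ := hα r hr'
    have h4 : -(r * |energy lam q (v r) (w r)|) ≤ r * α r * energy lam q (v r) (w r) := by
      have h5 : -|energy lam q (v r) (w r)| ≤ α r * energy lam q (v r) (w r) := by
        have := neg_abs_le (energy lam q (v r) (w r))
        nlinarith [abs_nonneg (energy lam q (v r) (w r))]
      nlinarith [hr.1]
    have h5 : -(μ * |v r * w r|) ≤ μ * α r * (v r * w r) := by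
      have h6 : -|v r * w r| ≤ α r * (v r * w r) := by
        have := neg_abs_le (v r * w r)
        nlinarith [abs_nonneg (v r * w r)]
      nlinarith
    have h6 : 0 ≤ C * r := mul_nonneg hC hr.1.le
    simp only [hQ, pohozaev]
    linarith
  have hs2 : s₁ / 2 ∈ Ioc 0 δ := ⟨by linarith [hs₁.1], by linarith [hs₁.1, hs₁.2]⟩
  set m := (s₁ / 2) ^ p * (D * (β / 2) ^ (q + 1) / 2) with hm
  have hsub2 : Icc (s₁ / 2) s₁ ⊆ Ioc 0 δ := fun s h => ⟨hs2.1.trans_le h.1, h.2.trans hs₁.2⟩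
  have hmono2 : MonotoneOn (fun s => Q s - m * s) (Icc (s₁ / 2) s₁) := by
    have hd := fun s h => (hQd s h).sub ((hasDerivAt_id s).const_mul m)
    refine monotoneOn_of_hasDerivWithinAt_nonneg (convex_Icc _ _)
      (fun s h => (hd s (hsub2 h)).continuousAt.continuousWithinAt)
      (fun s h => (hd s (hsub2 (interior_subset h))).hasDerivWithinAt) (fun s h => ?_)
    have h'' := interior_subset h
    have h' := hsub2 h''
    have h1 := hder s h'
    obtain ⟨-, h2, h3, h4⟩ := hα s h'
    have h5 : (β / 2) ^ (q + 1) ≤ |v s| ^ (q + 1) :=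
      Real.rpow_le_rpow (by positivity)
        ((hv s ⟨h'.1, h''.2⟩).trans (le_abs_self _)) (by linarith)
    have h6 : (s₁ / 2) ^ p ≤ α s := (Real.rpow_le_rpow hs2.1.le h''.1 hp.le).trans h4
    have h7 : D * (β / 2) ^ (q + 1) / 2 ≤ D * |v s| ^ (q + 1) - C := by
      nlinarith
    have h8 : m ≤ α s * (D * |v s| ^ (q + 1) - C) :=
      mul_le_mul h6 h7 (by positivity) h2.le
    linarith
  have h1 := hmono2 ⟨le_rfl, by linarith [hs₁.1]⟩ ⟨by linarith [hs₁.1], le_rfl⟩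
    (by linarith [hs₁.1] : s₁ / 2 ≤ s₁)
  have h2 := hzero _ hs2
  have h3 := hmono hs₁ ⟨hδ.1, le_rfl⟩ hs₁.2
  have h4 : (s₁ / 2) ^ (p + 1) * (D * (β / 2) ^ (q + 1) / 2) = m * (s₁ / 2) := by
    rw [hm, Real.rpow_add_one hs2.1.ne']; ring
  simp only at h1 h3
  rw [h4]
  nlinarith [mul_nonneg hC hs₁.1.le]

theorem pohozaev_le (hlam : 0 < lam) {E C μ a x y s : ℝ} (hμ : 0 < μ) (ha0 : 0 ≤ a) (ha1 : a ≤ 1)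
    (hs0 : 0 ≤ s) (hs1 : s ≤ 1) (hC : 0 ≤ C) (hE : y ^ 2 / 2 + lam * x ^ 2 / 2 ≤ E + C) :
    s * a * E + μ * a * (x * y) ≤ (1 + μ * (1 / lam + 1)) * (E + C) := by
  have hEC : 0 ≤ E + C := by
    have : 0 ≤ y ^ 2 / 2 + lam * x ^ 2 / 2 := by positivity
    linarith
  have h1 : s * a * E ≤ E + C := by
    have h2 : s * a ≤ 1 := mul_le_one₀ hs1 ha0 ha1
    have h3 : 0 ≤ s * a := mul_nonneg hs0 ha0
    nlinarith
  have h2 : x * y ≤ (1 / lam + 1) * (E + C) := by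
    have hx : x ^ 2 / 2 ≤ 1 / lam * (E + C) := by
      rw [one_div_mul_eq_div, le_div_iff₀ hlam]
      nlinarith [sq_nonneg y]
    have hy : y ^ 2 / 2 ≤ E + C := by nlinarith [mul_nonneg hlam.le (sq_nonneg x)]
    nlinarith [sq_nonneg (x - y)]
  have h3 : a * (x * y) ≤ (1 / lam + 1) * (E + C) := by
    have : 0 ≤ (1 / lam + 1) * (E + C) := by positivity
    nlinarith
  nlinarith

/-- For a subcritical exponent, the energy at some fixed radius tends to infinity with the
initial value. -/
theorem exists_energy_large {k : ℝ} (hlam : 0 < lam) (hq : 1 < q) (hk : 1 ≤ k)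
    (hqk : q * (k - 1) < k + 3) (hT : 0 < T) (hgc : ContinuousOn g (Ioo 0 T))
    (hg : ∀ s ∈ Ioo 0 T, 0 < g s)
    (hlim : Tendsto (fun s => s * g s) (nhdsWithin 0 (Ioi 0)) (nhds k)) :
    ∃ δ ∈ Ioo 0 T, ∀ M, ∀ᶠ β in atTop, ∀ v w, RadialSol g lam q T β v w →
      M ≤ energy lam q (v δ) (w δ) := by
  set m₁ := (k + 1) / (q + 1) - (k - 1) / 2 with hm₁
  have hm₁pos : 0 < m₁ := by
    rw [hm₁, sub_pos, lt_div_iff₀ (by linarith)]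
    linarith
  set m₂ := k + 3 - q * (k - 1) with hm₂
  have hm₂pos : 0 < m₂ := by rw [hm₂]; linarith
  set μ := ((k - 1) / 2 + (k + 1) / (q + 1)) / 2 with hμ
  have hμpos : 0 < μ := by
    have : 0 < (k + 1) / (q + 1) := by positivity
    rw [hμ]; linarith
  set ε := min 1 (min (m₁ / 2) (m₂ / (2 * (q - 1)))) with hε
  have hq1 : 0 < q - 1 := by linarith
  have hεpos : 0 < ε := by positivity
  have hε1 : ε ≤ 1 := min_le_left _ _
  have hε2 : ε ≤ m₁ / 2 := (min_le_right _ _).trans (min_le_left _ _)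
  have hε3 : ε ≤ m₂ / (2 * (q - 1)) := (min_le_right _ _).trans (min_le_right _ _)
  have hμε : 2 * (m₁ / 8) ≤ (k + 1 - ε) / (q + 1) - μ := by
    have h1 : ε / (q + 1) ≤ ε / 2 := by gcongr; linarith
    have h2 : (k + 1 - ε) / (q + 1) = (k + 1) / (q + 1) - ε / (q + 1) := sub_div _ _ _
    linarith
  obtain ⟨C, hC, hbound⟩ := exists_pohozaev_deriv_bound (k := k) hlam hq
    (by positivity : 0 < m₁ / 8) hμpos hε1 (by linarith) hμε
  obtain ⟨δ₀, hδ₀, hδ₀'⟩ : ∃ δ₀ > 0, ∀ s ∈ Ioo 0 δ₀, |s * g s - k| ≤ ε := by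
    have h1 := hlim (Metric.closedBall_mem_nhds k hεpos)
    obtain ⟨u, hu, hu'⟩ := mem_nhdsGT_iff_exists_Ioo_subset.1 h1
    exact ⟨u, hu, fun s h => by simpa [Real.dist_eq] using hu' h⟩
  set δ := min 1 (min (T / 2) (δ₀ / 2)) with hδdef
  have hδpos : 0 < δ := by positivity
  have hδ1 : δ ≤ 1 := min_le_left _ _
  have hδT : δ ≤ T / 2 := (min_le_right _ _).trans (min_le_left _ _)
  have hδδ : δ ≤ δ₀ / 2 := (min_le_right _ _).trans (min_le_right _ _)
  have hδ : δ ∈ Ioo 0 T := ⟨hδpos, by linarith⟩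
  have hgk : ∀ s ∈ Ioc 0 δ, |s * g s - k| ≤ ε := fun s h =>
    hδ₀' s ⟨h.1, by linarith [h.2]⟩
  obtain ⟨α, hα⟩ := exists_antiderivative_weight (p := k + ε) hgc hg hδ hδ1
    (fun s h => by linarith [(abs_le.1 (hgk s h)).2])
  obtain ⟨c, hc, hplateau⟩ := half_le_of_le (lam := lam) (q := q) (T := T) (g := g) hlam hq hg
  obtain ⟨C', hC', hlow⟩ := exists_energy_lower_bound hlam hq
  set D := lam * (m₁ / 8) with hD
  have hDpos : 0 < D := by positivity
  set A := 1 + μ * (1 / lam + 1) with hA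
  have hApos : 0 < A := by positivity
  set γ := q + 1 - (q - 1) / 2 * (k + ε + 1) with hγ
  have hγpos : 0 < γ := by
    rw [le_div_iff₀ (by linarith)] at hε3
    rw [hγ]
    nlinarith
  refine ⟨δ, hδ, fun M => ?_⟩
  set B := (c / 2) ^ (k + ε + 1) * (D * (1 / 2) ^ (q + 1) / 2) with hB
  have hBpos : 0 < B := by positivity
  have e1 : ∀ᶠ β : ℝ in atTop, c * β ^ (-((q - 1) / 2)) ≤ δ := by
    have := (tendsto_rpow_neg_atTop (by linarith : 0 < (q - 1) / 2)).const_mul c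
    rw [mul_zero] at this
    exact (this.eventually_lt_const hδpos).mono fun _ h => h.le
  have e2 : ∀ᶠ β : ℝ in atTop, 2 * C ≤ D * (β / 2) ^ (q + 1) :=
    ((((tendsto_rpow_atTop (by linarith : 0 < q + 1)).comp
      (tendsto_id.atTop_div_const (by norm_num : (0 : ℝ) < 2))).const_mul_atTop
        hDpos)).eventually_ge_atTop _
  have e3 : ∀ᶠ β : ℝ in atTop, A * (M + C') + C * δ ≤ B * β ^ γ :=
    ((tendsto_rpow_atTop hγpos).const_mul_atTop hBpos).eventually_ge_atTop _
  filter_upwards [e1, e2, e3, eventually_ge_atTop 1] with β h1 h2 h3 h4 v w hs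
  have hβ0 : 0 < β := by linarith
  set s₁ := c * β ^ (-((q - 1) / 2)) with hs₁
  have hs₁pos : 0 < s₁ := by positivity
  have h5 := hs.pohozaev_lower_bound hq hμpos hDpos hδ hC ⟨hs₁pos, h1⟩
    (by positivity : 0 < k + ε) hα
    (fun s h => hbound (α s) (s * g s) (w s) (v s) (hα s h).2.1.le (hα s h).2.2.1 (hgk s h))
    hβ0 (fun s h => hplateau β v w h4 hs s
      ⟨h.1.le, (h.2.trans h1).trans hδ.2.le⟩ h.2) h2
  have h6 := pohozaev_le (s := δ) hlam hμpos (hα δ ⟨hδpos, le_rfl⟩).2.1.le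
    (hα δ ⟨hδpos, le_rfl⟩).2.2.1 hδpos.le hδ1 hC' (hlow (v δ) (w δ))
  have h7 : (s₁ / 2) ^ (k + ε + 1) * (D * (β / 2) ^ (q + 1) / 2) = B * β ^ γ := by
    have h8 : β ^ γ = β ^ (q + 1) * β ^ (-((q - 1) / 2) * (k + ε + 1)) := by
      rw [← Real.rpow_add hβ0, hγ]
      congr 1
      ring
    rw [h8, hs₁, hB, show c * β ^ (-((q - 1) / 2)) / 2 = c / 2 * β ^ (-((q - 1) / 2)) by ring,
      show β / 2 = 1 / 2 * β by ring, Real.mul_rpow (by positivity) (by positivity),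
      Real.mul_rpow (by norm_num) hβ0.le, ← Real.rpow_mul hβ0.le]
    ring
  rw [h7] at h5
  rw [pohozaev] at h5
  have h8 : A * (M + C') ≤ A * (energy lam q (v δ) (w δ) + C') := by linarith
  have := le_of_mul_le_mul_left h8 hApos
  linarith

end RadialSol

/-- The derivative of a continuous polar angle of a differentiable planar curve. -/
theorem hasDerivAt_polarAngle {a b θ : ℝ → ℝ} {a' b' s : ℝ} (ha : HasDerivAt a a' s)
    (hb : HasDerivAt b b' s) (hθ : ContinuousAt θ s) (hne : a s ^ 2 + b s ^ 2 ≠ 0)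
    (hpol : ∀ᶠ x in nhds s, a x = √(a x ^ 2 + b x ^ 2) * Real.cos (θ x) ∧
      b x = √(a x ^ 2 + b x ^ 2) * Real.sin (θ x)) :
    HasDerivAt θ ((a s * b' - b s * a') / (a s ^ 2 + b s ^ 2)) s := by
  have hne' : a s * a s + b s * b s ≠ 0 := by simpa [sq] using hne
  have hpos : 0 < a s ^ 2 + b s ^ 2 := lt_of_le_of_ne (by positivity) hne.symm
  have hquot : HasDerivAt
      (fun x => θ s + Real.arctan ((b x * a s - a x * b s) / (a x * a s + b x * b s)))
      ((a s * b' - b s * a') / (a s ^ 2 + b s ^ 2)) s := by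
    have h1 := (((hb.mul_const (a s)).sub (ha.mul_const (b s))).div
      ((ha.mul_const (a s)).add (hb.mul_const (b s))) hne').arctan.const_add (θ s)
    refine h1.congr_deriv ?_
    have h2 : b s * a s - a s * b s = 0 := by ring
    simp only [Pi.add_apply, Pi.sub_apply, Pi.div_apply, h2, zero_div, zero_mul, sub_zero]
    field_simp
    ring
  refine hquot.congr_of_eventuallyEq ?_
  have hcont := hθ.sub_const (θ s)
  have h0 : ∀ᶠ x in nhds s, θ x - θ s ∈ Ioo (-(Real.pi / 2)) (Real.pi / 2) := by
    refine hcont (Ioo_mem_nhds ?_ ?_) <;> simp [Real.pi_pos]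
  have hnz : ∀ᶠ x in nhds s, a x ^ 2 + b x ^ 2 ≠ 0 :=
    ((ha.continuousAt.pow 2).add (hb.continuousAt.pow 2)).eventually_ne hne
  filter_upwards [h0, hpol, hnz] with x hx hpx hnx
  have hps := hpol.self_of_nhds
  set r := √(a x ^ 2 + b x ^ 2)
  set r₀ := √(a s ^ 2 + b s ^ 2)
  have hr : 0 < r := Real.sqrt_pos.2 (lt_of_le_of_ne (by positivity) hnx.symm)
  have hr₀ : 0 < r₀ := Real.sqrt_pos.2 hpos
  have h1 : b x * a s - a x * b s = r * r₀ * Real.sin (θ x - θ s) := by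
    rw [Real.sin_sub, hpx.1, hpx.2, hps.1, hps.2]; ring
  have h2 : a x * a s + b x * b s = r * r₀ * Real.cos (θ x - θ s) := by
    rw [Real.cos_sub, hpx.1, hpx.2, hps.1, hps.2]; ring
  rw [h1, h2, mul_div_mul_left _ _ (by positivity), ← Real.tan_eq_sin_div_cos,
    Real.arctan_tan hx.1 hx.2]
  ring

/-- Rescaling the second coordinate changes the polar angle by an explicit amount of absolute
value less than `π / 2`. -/
theorem polar_rescale {a b θ κ : ℝ} (hκ : 0 < κ) (hne : a ^ 2 + b ^ 2 ≠ 0)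
    (ha : a = √(a ^ 2 + b ^ 2) * Real.cos θ) (hb : b = √(a ^ 2 + b ^ 2) * Real.sin θ) :
    a = √(a ^ 2 + (κ * b) ^ 2) *
        Real.cos (θ + Real.arctan ((κ - 1) * (a * b) / (a ^ 2 + κ * b ^ 2))) ∧
      κ * b = √(a ^ 2 + (κ * b) ^ 2) *
        Real.sin (θ + Real.arctan ((κ - 1) * (a * b) / (a ^ 2 + κ * b ^ 2))) := by
  have hpos : 0 < a ^ 2 + b ^ 2 := lt_of_le_of_ne (by positivity) hne.symm
  have hP : 0 < a ^ 2 + κ * b ^ 2 := by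
    rcases eq_or_ne a 0 with rfl | h
    · have : 0 < b ^ 2 := by simpa using hpos
      positivity
    · positivity
  have hR : 0 < a ^ 2 + (κ * b) ^ 2 := by
    rcases eq_or_ne a 0 with rfl | h
    · have : 0 < b ^ 2 := by simpa using hpos
      rw [mul_pow]
      positivity
    · positivity
  set r := √(a ^ 2 + b ^ 2) with hr
  set ρ := √(a ^ 2 + (κ * b) ^ 2) with hρ
  have hr2 : r ^ 2 = a ^ 2 + b ^ 2 := Real.sq_sqrt hpos.le
  have hρ2 : ρ ^ 2 = a ^ 2 + (κ * b) ^ 2 := Real.sq_sqrt hR.le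
  have hr0 : 0 < r := Real.sqrt_pos.2 hpos
  have hρ0 : 0 < ρ := Real.sqrt_pos.2 hR
  have hs : √(1 + ((κ - 1) * (a * b) / (a ^ 2 + κ * b ^ 2)) ^ 2) =
      ρ * r / (a ^ 2 + κ * b ^ 2) := by
    rw [Real.sqrt_eq_iff_eq_sq (by positivity) (by positivity)]
    rw [div_pow, div_pow, mul_pow ρ, hr2, hρ2, eq_div_iff (by positivity), add_mul,
      div_mul_cancel₀ _ (by positivity)]
    ring
  have hc : Real.cos θ = a / r := by rw [eq_div_iff hr0.ne', mul_comm]; exact ha.symm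
  have hsn : Real.sin θ = b / r := by rw [eq_div_iff hr0.ne', mul_comm]; exact hb.symm
  rw [Real.cos_add, Real.sin_add, Real.cos_arctan, Real.sin_arctan, hs, hc, hsn]
  clear_value r ρ
  clear ha hb hr hρ hs hc hsn
  constructor
  · have : ρ * (a / r * (1 / (ρ * r / (a ^ 2 + κ * b ^ 2))) - b / r *
        ((κ - 1) * (a * b) / (a ^ 2 + κ * b ^ 2) / (ρ * r / (a ^ 2 + κ * b ^ 2)))) =
        (a * (a ^ 2 + b ^ 2)) / r ^ 2 := by
      field_simp
      ring
    rw [this, ← hr2]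
    field_simp
  · have : ρ * (b / r * (1 / (ρ * r / (a ^ 2 + κ * b ^ 2))) + a / r *
        ((κ - 1) * (a * b) / (a ^ 2 + κ * b ^ 2) / (ρ * r / (a ^ 2 + κ * b ^ 2)))) =
        (κ * b * (a ^ 2 + b ^ 2)) / r ^ 2 := by
      generalize hP' : a ^ 2 + κ * b ^ 2 = P at hP
      field_simp
      rw [← hP']
      ring
    rw [this, ← hr2]
    field_simp

/-- At high energy the rescaled phase-space vector rotates fast. -/
theorem exists_energy_rotation_bound {lam q Ω G : ℝ} (hlam : 0 < lam) (hq : 1 < q) (hΩ : 0 < Ω)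
    (hG : 2 * G ≤ Ω) (hΩlam : lam ≤ Ω ^ 2) :
    ∃ M, ∀ c x y, 0 ≤ c → c ≤ G → M ≤ energy lam q x y →
      Ω / 4 * (Ω ^ 2 * x ^ 2 + y ^ 2) ≤
        Ω * (y ^ 2 + c * (x * y) + lam * (x * nonlin q x)) := by
  obtain ⟨B₀, hB₀⟩ := eventually_atTop.1
    ((tendsto_rpow_atTop (by linarith : 0 < q - 1)).eventually_ge_atTop (Ω ^ 2 / lam + 1))
  set B := max B₀ 0
  have hB : 0 ≤ B := le_max_right _ _
  refine ⟨lam * B ^ (q + 1) + 2 * Ω ^ 2 * B ^ 2, fun c x y hc0 hc hE => ?_⟩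
  have hcross : -(1 / 4 * (Ω ^ 2 * x ^ 2 + y ^ 2)) ≤ c * (x * y) := by
    have h1 : |c * (x * y)| ≤ Ω / 2 * (|x| * |y|) := by
      rw [abs_mul, abs_mul, abs_of_nonneg hc0]
      gcongr
      linarith
    have h2 : 2 * (Ω * |x| * |y|) ≤ Ω ^ 2 * x ^ 2 + y ^ 2 := by
      rw [← sq_abs x, ← sq_abs y]
      nlinarith [sq_nonneg (Ω * |x| - |y|)]
    linarith [neg_abs_le (c * (x * y))]
  suffices 1 / 4 * (Ω ^ 2 * x ^ 2 + y ^ 2) ≤ y ^ 2 + c * (x * y) + lam * (x * nonlin q x) by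
    have := mul_le_mul_of_nonneg_left this hΩ.le
    linarith
  rw [mul_nonlin hq]
  rcases le_total B |x| with hx | hx
  · have h1 : Ω ^ 2 / lam + 1 ≤ |x| ^ (q - 1) := hB₀ _ ((le_max_left _ _).trans hx)
    have h2 : Ω ^ 2 ≤ lam * (|x| ^ (q - 1) - 1) := by
      rw [← div_le_iff₀' hlam]; linarith
    have h3 : Ω ^ 2 * x ^ 2 ≤ lam * (|x| ^ (q + 1) - x ^ 2) := by
      rw [abs_rpow_add_one hq]
      nlinarith [mul_le_mul_of_nonneg_right h2 (sq_nonneg x)]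
    nlinarith [sq_nonneg y, mul_nonneg (sq_nonneg Ω) (sq_nonneg x)]
  · have h1 : potential q x ≤ B ^ (q + 1) := (potential_le_rpow hq x).trans
      (Real.rpow_le_rpow (abs_nonneg _) hx (by linarith))
    have h2 : 4 * (Ω ^ 2 * B ^ 2) ≤ y ^ 2 := by
      rw [energy] at hE
      nlinarith [mul_le_mul_of_nonneg_left h1 hlam.le]
    have h3 : x ^ 2 ≤ B ^ 2 := by rw [← sq_abs x]; gcongr
    have h4 : Ω ^ 2 * x ^ 2 ≤ Ω ^ 2 * B ^ 2 := by gcongr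
    have h5 : lam * x ^ 2 ≤ Ω ^ 2 * x ^ 2 := by gcongr
    have h6 : 0 ≤ lam * |x| ^ (q + 1) := by positivity
    nlinarith

namespace RadialSol

variable {g : ℝ → ℝ} {lam q T β : ℝ} {v w : ℝ → ℝ}

theorem energy_propagation {C G δ : ℝ} (hs : RadialSol g lam q T β v w) (hlam : 0 < lam)
    (hq : 1 < q) (hG : 0 ≤ G) (hδ : δ ∈ Ioo 0 T) (hgG : ∀ s ∈ Ioo δ T, g s ≤ G)
    (hC : ∀ x y, y ^ 2 / 2 + lam * x ^ 2 / 2 ≤ energy lam q x y + C) {s : ℝ} (h : s ∈ Icc δ T) :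
    (energy lam q (v δ) (w δ) + C) * Real.exp (-(2 * G * (T - δ))) ≤
      energy lam q (v s) (w s) + C := by
  have hmono : MonotoneOn (fun s => Real.exp (2 * G * s) * (energy lam q (v s) (w s) + C))
      (Icc δ T) := by
    refine monotoneOn_of_hasDerivWithinAt_nonneg (convex_Icc δ T) ?_
      (fun x hx => by
        rw [interior_Icc] at hx
        exact ((((hasDerivAt_id x).const_mul (2 * G)).exp).mul
          ((hs.hasDerivAt_energy hq ⟨hδ.1.trans hx.1, hx.2⟩).add_const C)).hasDerivWithinAt)
      (fun x hx => ?_)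
    · exact (Continuous.continuousOn (by fun_prop)).mul
        (((hs.continuousOn_energy hq).mono (Icc_subset_Icc hδ.1.le le_rfl)).add continuousOn_const)
    · rw [interior_Icc] at hx
      have h1 := hgG x hx
      have h2 := hC (v x) (w x)
      have h3 : 0 ≤ 2 * G * (energy lam q (v x) (w x) + C) - g x * w x ^ 2 := by
        have h4 : 0 ≤ lam * v x ^ 2 / 2 := by positivity
        nlinarith [mul_le_mul_of_nonneg_right h1 (sq_nonneg (w x))]
      have h5 := mul_nonneg (Real.exp_pos (2 * G * x)).le h3
      simp only [id, mul_one]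
      linarith
  have h1 := hmono ⟨le_rfl, hδ.2.le⟩ h h.1
  simp only at h1
  have h2 : 0 ≤ energy lam q (v δ) (w δ) + C := by
    have h2 := hC (v δ) (w δ)
    have : 0 ≤ w δ ^ 2 / 2 + lam * v δ ^ 2 / 2 := by positivity
    linarith
  have h3 : Real.exp (-(2 * G * (T - δ))) ≤ Real.exp (-(2 * G * s)) * Real.exp (2 * G * δ) := by
    rw [← Real.exp_add]
    gcongr
    nlinarith [mul_nonneg hG (sub_nonneg.2 h.2)]
  calc (energy lam q (v δ) (w δ) + C) * Real.exp (-(2 * G * (T - δ)))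
      ≤ (energy lam q (v δ) (w δ) + C) * (Real.exp (-(2 * G * s)) * Real.exp (2 * G * δ)) := by
        gcongr
    _ = Real.exp (-(2 * G * s)) * (Real.exp (2 * G * δ) * (energy lam q (v δ) (w δ) + C)) := by
        ring
    _ ≤ Real.exp (-(2 * G * s)) * (Real.exp (2 * G * s) * (energy lam q (v s) (w s) + C)) := by
        gcongr
    _ = energy lam q (v s) (w s) + C := by
        rw [← mul_assoc, ← Real.exp_add, neg_add_cancel, Real.exp_zero, one_mul]

/-- `θ` is a continuous angle of the curve `(v, -v')` starting from `0`. -/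
structure Angle (T : ℝ) (v w θ : ℝ → ℝ) : Prop where
  cont : ContinuousOn θ (Icc 0 T)
  init : θ 0 = 0
  cos_eq : ∀ s ∈ Icc 0 T, v s = √(v s ^ 2 + (-w s) ^ 2) * Real.cos (θ s)
  sin_eq : ∀ s ∈ Icc 0 T, -w s = √(v s ^ 2 + (-w s) ^ 2) * Real.sin (θ s)

theorem neg_pi_div_two_le_angle (hs : RadialSol g lam q T β v w) {θ : ℝ → ℝ}
    (hθ : Angle T v w θ) (hne : ∀ s ∈ Icc 0 T, v s ^ 2 + w s ^ 2 ≠ 0) {s : ℝ} (h : s ∈ Icc 0 T) :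
    -(Real.pi / 2) ≤ θ s := by
  rcases h.1.eq_or_lt with rfl | hspos
  · rw [hθ.init]; linarith [Real.pi_pos]
  obtain ⟨a, ha, ha'⟩ : ∃ a ∈ Ioo 0 s, -(Real.pi / 2) ≤ θ a := by
    have h1 : Tendsto θ (nhdsWithin 0 (Ioo 0 s)) (nhds 0) := by
      have := hθ.cont 0 ⟨le_rfl, h.1.trans h.2⟩
      rw [ContinuousWithinAt, hθ.init] at this
      exact this.mono_left (nhdsWithin_mono _ fun x hx => ⟨hx.1.le, hx.2.le.trans h.2⟩)
    have : (nhdsWithin (0 : ℝ) (Ioo 0 s)).NeBot := left_nhdsWithin_Ioo_neBot hspos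
    have h2 := h1.eventually_const_lt (by linarith [Real.pi_pos] : -(Real.pi / 2) < 0)
    obtain ⟨a, h3, h4⟩ := (h2.and self_mem_nhdsWithin).exists
    exact ⟨a, h4, h3.le⟩
  have hd : ∀ x ∈ Ioo 0 T, HasDerivAt θ ((v x * (-(-(g x * w x) - lam * nonlin q (v x)))
      - (-w x) * w x) / (v x ^ 2 + (-w x) ^ 2)) x := fun x hx =>
    hasDerivAt_polarAngle (b := fun s => -w s) (hs.derivV x hx) (hs.derivW x hx).neg
      (hθ.cont.continuousAt (Icc_mem_nhds hx.1 hx.2))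
      (by simpa using hne x (Ioo_subset_Icc_self hx))
      (by filter_upwards [Icc_mem_nhds hx.1 hx.2] with y hy using ⟨hθ.cos_eq y hy, hθ.sin_eq y hy⟩)
  have hsub : ∀ x ∈ Ico a s, x ∈ Ioo 0 T := fun x hx =>
    ⟨ha.1.trans_le hx.1, hx.2.trans_le h.2⟩
  have := image_le_of_deriv_right_lt_deriv_boundary (f := fun x => -θ x) (a := a) (b := s)
    (B := fun _ => Real.pi / 2) (B' := fun _ => 0)
    (hθ.cont.mono (Icc_subset_Icc ha.1.le h.2)).neg
    (fun x hx => (hd x (hsub x hx)).neg.hasDerivWithinAt) (by linarith)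
    (fun x => hasDerivAt_const _ _) (fun x hx hx0 => ?_) ⟨ha.2.le, le_rfl⟩
  · linarith
  · have hx' := Ioo_subset_Icc_self (hsub x hx)
    have hv : v x = 0 := by
      rw [hθ.cos_eq x hx', show θ x = -(Real.pi / 2) by linarith, Real.cos_neg,
        Real.cos_pi_div_two, mul_zero]
    have h1 := hne x hx'
    rw [hv] at h1 ⊢
    have : w x ≠ 0 := by simpa using h1
    have h2 : 0 < w x ^ 2 := by positivity
    have h3 : (0 * (-(-(g x * w x) - lam * nonlin q 0)) - -w x * w x) / (0 ^ 2 + (-w x) ^ 2) = 1 := by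
      field_simp
      ring
    rw [h3]; norm_num

theorem angle_ge_of_rotation {Ω δ : ℝ} (hs : RadialSol g lam q T β v w) {θ : ℝ → ℝ}
    (hθ : Angle T v w θ) (hne : ∀ s ∈ Icc 0 T, v s ^ 2 + w s ^ 2 ≠ 0) (hδ : δ ∈ Ioo 0 T)
    (hΩ : 0 < Ω)
    (hrot : ∀ s ∈ Ioo δ T, Ω / 4 * (Ω ^ 2 * v s ^ 2 + w s ^ 2) ≤
      Ω * (w s ^ 2 + g s * (v s * w s) + lam * (v s * nonlin q (v s)))) :
    Ω / 4 * (T - δ) - 3 * Real.pi / 2 ≤ θ T := by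
  set κ := 1 / Ω with hκ
  have hκ0 : 0 < κ := by positivity
  have hne' : ∀ s ∈ Icc 0 T, v s ^ 2 + (-w s) ^ 2 ≠ 0 := by simpa using hne
  set ψ : ℝ → ℝ := fun s =>
    Real.arctan ((κ - 1) * (v s * -w s) / (v s ^ 2 + κ * (-w s) ^ 2)) with hψ
  have hpos : ∀ c : ℝ, 0 < c → ∀ s ∈ Icc 0 T, v s ^ 2 + c * (-w s) ^ 2 ≠ 0 := by
    intro c hc s h h0
    refine hne' s h ?_
    have h1 : v s ^ 2 = 0 := by nlinarith [sq_nonneg (v s), mul_nonneg hc.le (sq_nonneg (-w s))]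
    have h2 : c * (-w s) ^ 2 = 0 := by linarith
    rw [h1, (mul_eq_zero.1 h2).resolve_left hc.ne', add_zero]
  have hφc : ContinuousOn (fun s => θ s + ψ s) (Icc 0 T) :=
    hθ.cont.add (Real.continuous_arctan.comp_continuousOn
      ((continuousOn_const.mul (hs.contV.mul hs.contW.neg)).div
        ((hs.contV.pow 2).add (continuousOn_const.mul (hs.contW.neg.pow 2)))
        (hpos κ hκ0)))
  have hd : ∀ x ∈ Ioo 0 T, HasDerivAt (fun s => θ s + ψ s)
      ((v x * (κ * -(-(g x * w x) - lam * nonlin q (v x)))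
        - (κ * -w x) * w x) / (v x ^ 2 + (κ * -w x) ^ 2)) x := fun x hx =>
    hasDerivAt_polarAngle (b := fun s => κ * -w s) (hs.derivV x hx)
      ((hs.derivW x hx).neg.const_mul κ)
      (hφc.continuousAt (Icc_mem_nhds hx.1 hx.2))
      (by
        have := hpos (κ ^ 2) (by positivity) x (Ioo_subset_Icc_self hx)
        rwa [mul_pow])
      (by
        filter_upwards [Icc_mem_nhds hx.1 hx.2] with y hy
        exact polar_rescale hκ0 (hne' y hy) (hθ.cos_eq y hy) (hθ.sin_eq y hy))
  have hmono : MonotoneOn (fun s => θ s + ψ s - Ω / 4 * s) (Icc δ T) := by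
    refine monotoneOn_of_hasDerivWithinAt_nonneg (convex_Icc δ T)
      ((hφc.mono (Icc_subset_Icc hδ.1.le le_rfl)).sub (Continuous.continuousOn (by fun_prop)))
      (fun x hx => by
        rw [interior_Icc] at hx
        exact ((hd x ⟨hδ.1.trans hx.1, hx.2⟩).sub
          ((hasDerivAt_id x).const_mul (Ω / 4))).hasDerivWithinAt) (fun x hx => ?_)
    rw [interior_Icc] at hx
    have h1 := hrot x hx
    have h2 : 0 < Ω ^ 2 * v x ^ 2 + w x ^ 2 := by
      have h3 := hpos (κ ^ 2) (by positivity) x ⟨hδ.1.le.trans hx.1.le, hx.2.le⟩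
      refine lt_of_le_of_ne (by positivity) fun h4 => h3 ?_
      rw [hκ]
      field_simp
      linarith
    have h3 : (v x * (κ * -(-(g x * w x) - lam * nonlin q (v x)))
        - (κ * -w x) * w x) / (v x ^ 2 + (κ * -w x) ^ 2) =
        Ω * (w x ^ 2 + g x * (v x * w x) + lam * (v x * nonlin q (v x))) /
          (Ω ^ 2 * v x ^ 2 + w x ^ 2) := by
      have h4 : v x ^ 2 + (κ * -w x) ^ 2 = (Ω ^ 2 * v x ^ 2 + w x ^ 2) / Ω ^ 2 := by
        rw [hκ]; field_simp
      rw [h4, hκ]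
      field_simp
      ring
    rw [h3, mul_one, sub_nonneg, le_div_iff₀ h2]
    exact h1
  have h1 := hmono ⟨le_rfl, hδ.2.le⟩ ⟨hδ.2.le, le_rfl⟩ hδ.2.le
  have h2 := hs.neg_pi_div_two_le_angle hθ hne (Ioo_subset_Icc_self hδ)
  have h3 : ψ T < Real.pi / 2 := Real.arctan_lt_pi_div_two _
  have h4 : -(Real.pi / 2) < ψ δ := Real.neg_pi_div_two_lt_arctan _
  simp only at h1
  linarith

/-- The total rotation of `(v, -v')` on `[0, T]` tends to infinity with the initial value. -/
theorem exists_angle_large {k : ℝ} (hlam : 0 < lam) (hq : 1 < q) (hk : 1 ≤ k)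
    (hqk : q * (k - 1) < k + 3) (hT : 0 < T) (hgc : ContinuousOn g (Ioo 0 T))
    (hg : ∀ s ∈ Ioo 0 T, 0 < g s) (hgb : ∀ δ ∈ Ioo 0 T, ∃ G, ∀ s ∈ Ioo δ T, g s ≤ G)
    (hlim : Tendsto (fun s => s * g s) (nhdsWithin 0 (Ioi 0)) (nhds k)) (K : ℝ) :
    ∀ᶠ β in atTop, ∀ v w θ, RadialSol g lam q T β v w → Angle T v w θ → K < θ T := by
  obtain ⟨δ, hδ, hlarge⟩ := exists_energy_large hlam hq hk hqk hT hgc hg hlim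
  obtain ⟨G₀, hG₀⟩ := hgb δ hδ
  set G := |G₀|
  have hG : ∀ s ∈ Ioo δ T, g s ≤ G := fun s h => (hG₀ s h).trans (le_abs_self _)
  have hTδ : 0 < T - δ := sub_pos.2 hδ.2
  set Ω := 1 + lam + 2 * G + 4 / (T - δ) * (|K| + 3 * Real.pi / 2) with hΩ
  have hGnn : 0 ≤ G := abs_nonneg _
  have h4 : 0 ≤ 4 / (T - δ) * (|K| + 3 * Real.pi / 2) := by positivity
  have hΩ0 : 0 < Ω := by positivity
  have hΩ1 : 1 + lam ≤ Ω := by rw [hΩ]; linarith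
  obtain ⟨M, hM⟩ := exists_energy_rotation_bound (G := G) hlam hq hΩ0 (by rw [hΩ]; linarith)
    (by nlinarith : lam ≤ Ω ^ 2)
  obtain ⟨C, hC, hlow⟩ := exists_energy_lower_bound hlam hq
  filter_upwards [hlarge ((M + C) * Real.exp (2 * G * (T - δ)) - C), eventually_gt_atTop 0]
    with β hβ hβ0 v w θ hs hθ
  have hne : ∀ s ∈ Icc 0 T, v s ^ 2 + w s ^ 2 ≠ 0 := fun s h =>
    hs.ne_zero hlam hq hg hgb hβ0.ne' h
  have hE : ∀ s ∈ Icc δ T, M ≤ energy lam q (v s) (w s) := by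
    intro s h
    have h1 := hs.energy_propagation hlam hq hGnn hδ hG hlow h
    have h2 : M + C ≤ (energy lam q (v δ) (w δ) + C) * Real.exp (-(2 * G * (T - δ))) := by
      rw [Real.exp_neg, ← div_eq_mul_inv, le_div_iff₀ (Real.exp_pos _)]
      linarith [hβ v w hs]
    linarith
  have h5 := hs.angle_ge_of_rotation hθ hne hδ hΩ0 fun s h =>
    hM (g s) (v s) (w s) (hg s ⟨hδ.1.trans h.1, h.2⟩).le (hG s h) (hE s (Ioo_subset_Icc_self h))
  have h6 : (1 + lam + 2 * G) * (T - δ) / 4 + |K| + 3 * Real.pi / 2 = Ω / 4 * (T - δ) := by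
    rw [hΩ]; field_simp; ring
  have h7 : 0 < (1 + lam + 2 * G) * (T - δ) / 4 := by positivity
  linarith [le_abs_self K]

end RadialSol

/-- A jointly continuous nonvanishing planar vector field over the plane has a continuous polar
angle. -/
theorem exists_continuous_polarAngle {F G : ℝ × ℝ → ℝ} (hF : Continuous F) (hG : Continuous G)
    (hne : ∀ p, F p ^ 2 + G p ^ 2 ≠ 0) :
    ∃ Θ : ℝ × ℝ → ℝ, Continuous Θ ∧ ∀ p, F p = √(F p ^ 2 + G p ^ 2) * Real.cos (Θ p) ∧
      G p = √(F p ^ 2 + G p ^ 2) * Real.sin (Θ p) := by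
  set z : C(ℝ × ℝ, ℂ) := ⟨fun p => ⟨F p, G p⟩, by
    have : (fun p => (⟨F p, G p⟩ : ℂ)) = fun p => (F p : ℂ) + G p * Complex.I := by
      ext p; apply Complex.ext <;> simp
    rw [this]
    fun_prop⟩
  have hz : ∀ p, z p ≠ 0 := fun p hp => hne p (by
    have h1 : F p = 0 := congrArg Complex.re hp
    have h2 : G p = 0 := congrArg Complex.im hp
    simp [h1, h2])
  obtain ⟨f, ⟨-, hf⟩, -⟩ := Complex.isCoveringMapOn_exp.existsUnique_continuousMap_lifts z
    (Complex.exp_log (hz 0)) hz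
  refine ⟨fun p => (f p).im, Complex.continuous_im.comp f.continuous, fun p => ?_⟩
  have h1 : Complex.exp (f p) = z p := congrFun hf p
  have h2 : √(F p ^ 2 + G p ^ 2) = Real.exp (f p).re := by
    rw [← Complex.norm_exp, h1, Complex.norm_def, Complex.normSq_apply, sq, sq]
    rfl
  have h3 := congrArg Complex.re h1
  have h4 := congrArg Complex.im h1
  rw [Complex.exp_re] at h3
  rw [Complex.exp_im] at h4
  rw [h2]
  exact ⟨h3.symm, h4.symm⟩

/-- Two continuous angles of the same directions which agree at a point are equal. -/
theorem eqOn_angle {X : Type*} [TopologicalSpace X] {S : Set X} (hS : IsPreconnected S)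
    {φ ψ : X → ℝ} (hφ : ContinuousOn φ S) (hψ : ContinuousOn ψ S)
    (hcos : ∀ x ∈ S, Real.cos (φ x) = Real.cos (ψ x))
    (hsin : ∀ x ∈ S, Real.sin (φ x) = Real.sin (ψ x)) {x₀ : X} (hx₀ : x₀ ∈ S)
    (h0 : φ x₀ = ψ x₀) : EqOn φ ψ S := by
  obtain ⟨y, -, hy⟩ := hS.eqOn_const_of_mapsTo
    (T := (AddSubgroup.zmultiples (2 * Real.pi) : Set ℝ)) ⟨inferInstanceAs (DiscreteTopology (AddSubgroup.zmultiples (2 * Real.pi)))⟩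
    (hφ.sub hψ) (fun x hx => by
      have h1 := Real.Angle.cos_sin_inj (hcos x hx) (hsin x hx)
      obtain ⟨n, hn⟩ := Real.Angle.angle_eq_iff_two_pi_dvd_sub.1 h1
      exact ⟨n, by simp [hn, mul_comm]⟩) ⟨0, zero_mem _⟩
  have h1 : φ x₀ - ψ x₀ = y := hy hx₀
  intro x hx
  have h2 : φ x - ψ x = y := hy hx
  linarith

/-- A family of continuous functions depending in a locally Lipschitz way on a parameter is
jointly continuous. -/
theorem continuousOn_family {f : ℝ → ℝ → ℝ} {S : Set ℝ} (hc : ∀ β, ContinuousOn (f β) S)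
    (hl : ∀ B, ∃ C, ∀ β β', |β| ≤ B → |β'| ≤ B → ∀ s ∈ S,
      (f β s - f β' s) ^ 2 ≤ C * (β - β') ^ 2) :
    ContinuousOn (fun p : ℝ × ℝ => f p.1 p.2) (univ ×ˢ S) := by
  rintro ⟨β₀, s₀⟩ ⟨-, hs₀⟩
  obtain ⟨C, hC⟩ := hl (|β₀| + 1)
  have h1 : ContinuousOn (fun p : ℝ × ℝ => f p.1 p.2) (Icc (-(|β₀| + 1)) (|β₀| + 1) ×ˢ S) := by
    refine continuousOn_prod_of_continuousOn_lipschitzOnWith _ (√C).toNNReal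
      (fun β _ => hc β) fun s hs => LipschitzOnWith.of_dist_le_mul fun β hβ β' hβ' => ?_
    rw [Real.coe_toNNReal _ (Real.sqrt_nonneg _), Real.dist_eq, Real.dist_eq,
      ← Real.sqrt_sq_eq_abs, ← Real.sqrt_sq_eq_abs (β - β'),
      ← Real.sqrt_mul' _ (sq_nonneg _)]
    exact Real.sqrt_le_sqrt (hC β β' (abs_le.2 hβ) (abs_le.2 hβ') s hs)
  have h2 : (β₀, s₀) ∈ Icc (-(|β₀| + 1)) (|β₀| + 1) ×ˢ S :=
    ⟨abs_le.1 (by linarith), hs₀⟩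
  refine (h1 _ h2).mono_of_mem_nhdsWithin ?_
  rw [nhdsWithin_prod_eq, nhdsWithin_univ]
  refine prod_mem_prod ?_ self_mem_nhdsWithin
  exact Icc_mem_nhds (by linarith [neg_abs_le β₀]) (by linarith [le_abs_self β₀])

namespace RadialSol

variable {g : ℝ → ℝ} {lam q T : ℝ}

theorem const_one : RadialSol g lam q T 1 (fun _ => 1) (fun _ => 0) where
  contV := continuousOn_const
  contW := continuousOn_const
  derivV s _ := hasDerivAt_const s 1
  derivW s _ := by simpa [nonlin] using hasDerivAt_const s (0 : ℝ)
  initV := rfl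
  initW := rfl

/-- The polar angles of the solutions with positive initial value can be chosen continuously in
the initial value, and they vanish identically for the initial value `1`. -/
theorem exists_angle_family {v w : ℝ → ℝ → ℝ} (hlam : 0 < lam) (hq : 1 < q) (hT : 0 < T)
    (hg : ∀ s ∈ Ioo 0 T, 0 < g s) (hgb : ∀ δ ∈ Ioo 0 T, ∃ G, ∀ s ∈ Ioo δ T, g s ≤ G)
    (hs : ∀ β, RadialSol g lam q T β (v β) (w β)) :
    ∃ θ : ℝ → ℝ → ℝ, ContinuousOn (fun β => θ β T) (Ioi 0) ∧ θ 1 T = 0 ∧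
      ∀ β, 0 < β → Angle T (v β) (w β) (θ β) := by
  have hdep := dependence (g := g) (T := T) hlam hq hg
  have hv : ContinuousOn (fun p : ℝ × ℝ => v p.1 p.2) (univ ×ˢ Icc 0 T) :=
    continuousOn_family (fun β => (hs β).contV) fun B => by
      obtain ⟨C, -, hC⟩ := hdep B
      exact ⟨C, fun β β' h h' s hsT => by
        nlinarith [hC _ _ _ _ _ _ h h' (hs β) (hs β') s hsT, sq_nonneg (w β s - w β' s)]⟩
  have hw : ContinuousOn (fun p : ℝ × ℝ => w p.1 p.2) (univ ×ˢ Icc 0 T) :=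
    continuousOn_family (fun β => (hs β).contW) fun B => by
      obtain ⟨C, -, hC⟩ := hdep B
      exact ⟨C, fun β β' h h' s hsT => by
        nlinarith [hC _ _ _ _ _ _ h h' (hs β) (hs β') s hsT, sq_nonneg (v β s - v β' s)]⟩
  set π : ℝ × ℝ → ℝ × ℝ := fun p => (Real.exp p.1, projIcc 0 T hT.le p.2) with hπ
  have hπc : Continuous π := by
    refine (Real.continuous_exp.comp continuous_fst).prodMk ?_
    exact continuous_subtype_val.comp (continuous_projIcc.comp continuous_snd)
  have hπm : ∀ p, π p ∈ (univ : Set ℝ) ×ˢ Icc 0 T := fun p =>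
    ⟨mem_univ _, (projIcc 0 T hT.le p.2).2⟩
  obtain ⟨Θ, hΘ, hpol⟩ := exists_continuous_polarAngle
    (F := fun p => v (π p).1 (π p).2) (G := fun p => -w (π p).1 (π p).2)
    (hv.comp_continuous hπc hπm) (hw.comp_continuous hπc hπm).neg
    (fun p => by
      rw [neg_sq]
      exact (hs _).ne_zero hlam hq hg hgb (Real.exp_pos _).ne' (hπm p).2)
  have hπs : ∀ x, ∀ s ∈ Icc 0 T, π (x, s) = (Real.exp x, s) := fun x s h => by
    simp [hπ, projIcc_of_mem hT.le h]
  have h0T : (0 : ℝ) ∈ Icc 0 T := ⟨le_rfl, hT.le⟩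
  have hTT : T ∈ Icc 0 T := ⟨hT.le, le_rfl⟩
  have hinit : ∀ x, Real.cos (Θ (x, 0)) = 1 ∧ Real.sin (Θ (x, 0)) = 0 := fun x => by
    have h1 := hpol (x, 0)
    simp only [hπs x 0 h0T, (hs _).initV, (hs _).initW, neg_zero] at h1
    have h2 : √(Real.exp x ^ 2 + 0 ^ 2) = Real.exp x := by
      simp [Real.sqrt_sq (Real.exp_pos x).le]
    rw [h2] at h1
    have h3 := (Real.exp_pos x).ne'
    exact ⟨by simpa [h3] using h1.1.symm, by simpa [h3] using h1.2.symm⟩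
  have hline : ∀ x, Θ (x, 0) = Θ (0, 0) := fun x =>
    eqOn_angle (S := univ) isPreconnected_univ (φ := fun x => Θ (x, 0))
      (ψ := fun _ => Θ (0, 0)) (Continuous.continuousOn (by fun_prop)) continuousOn_const
      (fun x _ => by rw [(hinit x).1, (hinit 0).1]) (fun x _ => by rw [(hinit x).2, (hinit 0).2])
      (mem_univ 0) rfl (mem_univ x)
  have hcs : ∀ s ∈ Icc 0 T, Real.cos (Θ (0, s)) = 1 ∧ Real.sin (Θ (0, s)) = 0 := fun s h => by
    obtain ⟨C, -, hC⟩ := hdep 1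
    have h1 := hC _ _ _ _ _ _ (by simp) (by simp) (hs 1) const_one s h
    have h2 : v 1 s = 1 := by nlinarith [sq_nonneg (v 1 s - 1), sq_nonneg (w 1 s - 0)]
    have h3 : w 1 s = 0 := by nlinarith [sq_nonneg (v 1 s - 1), sq_nonneg (w 1 s - 0)]
    have h4 := hpol (0, s)
    simp only [hπs 0 s h, Real.exp_zero, h2, h3] at h4
    simpa [eq_comm] using h4
  have hone : ∀ s ∈ Icc 0 T, Θ (0, s) = Θ (0, 0) := fun s hsT =>
    eqOn_angle (S := Icc 0 T) isPreconnected_Icc (φ := fun s => Θ (0, s))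
      (ψ := fun _ => Θ (0, 0)) (Continuous.continuousOn (by fun_prop)) continuousOn_const
      (fun s h => by rw [(hcs s h).1, (hinit 0).1]) (fun s h => by rw [(hcs s h).2, (hinit 0).2])
      h0T rfl hsT
  have hshift : ∀ x, Real.cos (x - Θ (0, 0)) = Real.cos x ∧
      Real.sin (x - Θ (0, 0)) = Real.sin x := fun x => by
    simp [Real.cos_sub, Real.sin_sub, hinit 0]
  refine ⟨fun β s => Θ (Real.log β, s) - Θ (0, 0), ?_, ?_, fun β hβ => ⟨?_, ?_, ?_, ?_⟩⟩
  · refine ContinuousOn.sub (hΘ.comp_continuousOn (ContinuousOn.prodMk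
      (Real.continuousOn_log.mono fun x hx => (ne_of_gt hx : x ≠ 0)) continuousOn_const))
      continuousOn_const
  · simp [hone T hTT]
  · exact Continuous.continuousOn (by fun_prop)
  · simp [hline]
  · intro s h
    have h1 := (hpol (Real.log β, s)).1
    rw [hπs _ s h, Real.exp_log hβ] at h1
    rw [(hshift _).1]
    exact h1
  · intro s h
    have h1 := (hpol (Real.log β, s)).2
    rw [hπs _ s h, Real.exp_log hβ] at h1
    rw [(hshift _).2]
    exact h1

end RadialSol

/-- Reversing time from the right endpoint turns a solution into a radial solution. -/
theorem SolOn.radialSol {h u u' u'' : ℝ → ℝ} {lam q t₀ d β : ℝ}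
    (hu : SolOn h lam q (Icc t₀ d) (Ico t₀ d) u u' u'') (hβ : u d = β) (h0 : u' d = 0) :
    RadialSol (fun s => -h (d - s)) lam q (d - t₀) β (fun s => u (d - s))
      (fun s => -u' (d - s)) := by
  obtain ⟨h1, h2, h3, -, h5⟩ := hu
  have hmaps : MapsTo (fun s => d - s) (Icc 0 (d - t₀)) (Icc t₀ d) := fun s hs =>
    ⟨by linarith [hs.2], by linarith [hs.1]⟩
  have hsub : ∀ s, HasDerivAt (fun s => d - s) (-1) s := fun s => (hasDerivAt_id s).const_sub d
  have hmem : ∀ s ∈ Ioo 0 (d - t₀), d - s ∈ Ioo t₀ d := fun s hs =>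
    ⟨by linarith [hs.2], by linarith [hs.1]⟩
  have hcont : ContinuousOn (fun s => d - s) (Icc 0 (d - t₀)) :=
    Continuous.continuousOn (by fun_prop)
  refine ⟨?_, (h2.comp hcont hmaps).neg, fun s hs => ?_, fun s hs => ?_, by simpa using hβ,
    by simpa using h0⟩
  · exact ContinuousOn.comp (fun t ht => (h1 t ht).continuousWithinAt) hcont hmaps
  · have ht := hmem s hs
    have h4 := (h1 _ (Ioo_subset_Icc_self ht)).hasDerivAt (Icc_mem_nhds ht.1 ht.2)
    exact (h4.comp s (hsub s)).congr_deriv (by ring)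
  · have ht := hmem s hs
    have h4 := (h3 _ (Ioo_subset_Ico_self ht)).hasDerivAt (Ico_mem_nhds ht.1 ht.2)
    refine (h4.comp s (hsub s)).neg.congr_deriv ?_
    have h6 := h5 _ (Ioo_subset_Ico_self ht)
    rw [nonlin]
    linarith

theorem stmt_10
    (d lam : ℝ) (hd : 0 < d) (hlam : 0 < lam)
    (n m₁ m₂ : ℤ) (hn : 3 ≤ n)
    (hm₁0 : 0 ≤ m₁) (hm₁n : m₁ ≤ n - 2) (hm₂0 : 0 ≤ m₂) (hm₂n : m₂ ≤ n - 2)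
    (h : ℝ → ℝ) (hC1 : ContDiffOn ℝ 1 h (Set.Ioo 0 d))
    (hder : ∀ t ∈ Set.Ioo 0 d, deriv h t < 0)
    (hlim0 : Filter.Tendsto (fun t => t * h t) (nhdsWithin 0 (Set.Ioi 0))
      (nhds ((n : ℝ) - (m₁ : ℝ) - 1)))
    (hlimd : Filter.Tendsto (fun t => (t - d) * h t) (nhdsWithin d (Set.Iio d))
      (nhds ((n : ℝ) - (m₂ : ℝ) - 1)))
    (q : ℝ) (hq1 : 1 < q)
    (hqsub : min m₁ m₂ < n - 2 →
      q < ((n : ℝ) - (min m₁ m₂ : ℝ) + 2) / ((n : ℝ) - (min m₁ m₂ : ℝ) - 2))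
    (t₀ : ℝ) (ht₀ : t₀ ∈ Set.Ioo 0 d)
    (hpos : ∀ t ∈ Set.Ioo 0 t₀, 0 < h t) (hneg : ∀ t ∈ Set.Ioo t₀ d, h t < 0)
    (V V' V'' : ℝ → ℝ → ℝ)
    (hV : ∀ β : ℝ, SolOn h lam q (Set.Icc t₀ d) (Set.Ico t₀ d) (V β) (V' β) (V'' β) ∧
      V β d = β ∧ V' β d = 0)
    (hVuniq : ∀ β : ℝ, ∀ u u' u'' : ℝ → ℝ,
      SolOn h lam q (Set.Icc t₀ d) (Set.Ico t₀ d) u u' u'' → u d = β → u' d = 0 →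
      ∀ t ∈ Set.Icc t₀ d, u t = V β t ∧ u' t = V' β t)
    (b : ℝ → ℝ) (hbCont : ContinuousOn b (Set.Ioi 0)) (hb1 : b 1 = 0)
    (hbAngle : ∀ β : ℝ, 0 < β →
      V β t₀ = enorm2 (V β t₀, V' β t₀) * Real.cos (b β) ∧
      V' β t₀ = enorm2 (V β t₀, V' β t₀) * Real.sin (b β))
    :
    ∀ K : ℝ, 0 < K → ∃ β₀ : ℝ, 0 < β₀ ∧ ∀ β : ℝ, β₀ ≤ β → K < b β := by
  have hT : 0 < d - t₀ := sub_pos.2 ht₀.2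
  have hsol := fun β => (hV β).1.radialSol (hV β).2.1 (hV β).2.2
  have hmem : ∀ s ∈ Ioo 0 (d - t₀), d - s ∈ Ioo t₀ d := fun s hs =>
    ⟨by linarith [hs.2], by linarith [hs.1]⟩
  have hmem' : ∀ s ∈ Ioo 0 (d - t₀), d - s ∈ Ioo 0 d := fun s hs =>
    ⟨ht₀.1.trans (hmem s hs).1, (hmem s hs).2⟩
  have hg : ∀ s ∈ Ioo 0 (d - t₀), 0 < -h (d - s) := fun s hs => neg_pos.2 (hneg _ (hmem s hs))
  have hanti : AntitoneOn h (Ioo 0 d) :=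
    (strictAntiOn_of_deriv_neg (convex_Ioo 0 d) hC1.continuousOn
      (by rwa [interior_Ioo])).antitoneOn
  have hgc : ContinuousOn (fun s => -h (d - s)) (Ioo 0 (d - t₀)) :=
    (hC1.continuousOn.comp (Continuous.continuousOn (by fun_prop)) hmem').neg
  have hgb : ∀ δ ∈ Ioo 0 (d - t₀), ∃ G, ∀ s ∈ Ioo δ (d - t₀), -h (d - s) ≤ G :=
    fun δ hδ => ⟨-h (d - δ), fun s hs => neg_le_neg
      (hanti (hmem' s ⟨hδ.1.trans hs.1, hs.2⟩) (hmem' δ hδ) (by linarith [hs.1]))⟩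
  have hlim : Tendsto (fun s => s * -h (d - s)) (nhdsWithin 0 (Ioi 0))
      (nhds ((n : ℝ) - m₂ - 1)) := by
    have h1 : Tendsto (fun s => d - s) (nhdsWithin 0 (Ioi 0)) (nhdsWithin d (Iio d)) := by
      refine tendsto_nhdsWithin_iff.2 ⟨?_, ?_⟩
      · have h2 : Tendsto (fun s => d - s) (nhds 0) (nhds (d - 0)) :=
          Continuous.tendsto (by fun_prop) 0
        rw [sub_zero] at h2
        exact h2.mono_left nhdsWithin_le_nhds
      · filter_upwards [self_mem_nhdsWithin] with s hs
        have : 0 < s := hs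
        simpa using this
    refine (hlimd.comp h1).congr fun s => ?_
    simp only [Function.comp_apply]
    ring
  have hm₂r : (m₂ : ℝ) ≤ n - 2 := by exact_mod_cast hm₂n
  have hk : (1 : ℝ) ≤ (n : ℝ) - m₂ - 1 := by linarith
  have hqk : q * (((n : ℝ) - m₂ - 1) - 1) < ((n : ℝ) - m₂ - 1) + 3 := by
    rcases hm₂n.eq_or_lt with h1 | h1
    · rw [h1]; push_cast; ring_nf; norm_num
    · have h2 := hqsub ((min_le_right _ _).trans_lt h1)
      have h3 : (m₂ : ℝ) < n - 2 := by exact_mod_cast h1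
      have h4 : min (m₁ : ℝ) m₂ ≤ m₂ := min_le_right _ _
      rw [lt_div_iff₀ (by linarith)] at h2
      nlinarith
  obtain ⟨θ, hθc, hθ1, hθ⟩ := RadialSol.exists_angle_family hlam hq1 hT hg hgb hsol
  have hb : EqOn b (fun β => θ β (d - t₀)) (Ioi 0) := by
    have hTT : d - t₀ ∈ Icc 0 (d - t₀) := ⟨hT.le, le_rfl⟩
    have hcs : ∀ β ∈ Ioi (0 : ℝ), Real.cos (b β) = Real.cos (θ β (d - t₀)) ∧
        Real.sin (b β) = Real.sin (θ β (d - t₀)) := by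
      intro β hβ
      have h1 := (hθ β hβ).cos_eq _ hTT
      have h2 := (hθ β hβ).sin_eq _ hTT
      have h3 := (hsol β).ne_zero hlam hq1 hg hgb (ne_of_gt hβ) hTT
      simp only [sub_sub_cancel, neg_neg, neg_sq] at h1 h2 h3
      have h4 := hbAngle β hβ
      rw [enorm2] at h4
      have h5 : √(V β t₀ ^ 2 + V' β t₀ ^ 2) ≠ 0 :=
        (Real.sqrt_pos.2 (lt_of_le_of_ne (by positivity) h3.symm)).ne'
      exact ⟨mul_left_cancel₀ h5 (h4.1.symm.trans h1), mul_left_cancel₀ h5 (h4.2.symm.trans h2)⟩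
    exact eqOn_angle isPreconnected_Ioi hbCont hθc (fun β hβ => (hcs β hβ).1)
      (fun β hβ => (hcs β hβ).2) (x₀ := 1) (mem_Ioi.2 one_pos) (by rw [hb1, hθ1])
  intro K _
  obtain ⟨β₁, hβ₁⟩ := eventually_atTop.1
    (RadialSol.exists_angle_large hlam hq1 hk hqk hT hgc hg hgb hlim K)
  refine ⟨max β₁ 1, lt_max_of_lt_right one_pos, fun β hβ => ?_⟩
  have hβ0 : 0 < β := one_pos.trans_le ((le_max_right _ _).trans hβ)
  rw [hb hβ0]
  exact hβ₁ β ((le_max_left _ _).trans hβ) _ _ _ (hsol β) (hθ β hβ0)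
end

section
/- For every α > 1 one has a(α) < π/2. -/
open Set Filter

open Real in
lemma le_mul_exp_of_deriv_le_mul {f f' : ℝ → ℝ} {a b C : ℝ} (hf : ContinuousOn f (Icc a b))
    (hf' : ∀ t ∈ Ioo a b, HasDerivAt f (f' t) t) (hle : ∀ t ∈ Ioo a b, f' t ≤ C * f t) :
    ∀ t ∈ Icc a b, f t ≤ f a * exp (C * (t - a)) := by
  have hanti : AntitoneOn (fun t => f t * exp (-C * (t - a))) (Icc a b) := by
    refine antitoneOn_of_hasDerivWithinAt_nonpos (convex_Icc a b)
      (f' := fun t => f' t * exp (-C * (t - a)) + f t * (exp (-C * (t - a)) * (-C))) ?_ ?_ ?_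
    · exact hf.mul (by fun_prop)
    · intro t ht
      rw [interior_Icc] at ht
      have hlin : HasDerivAt (fun t : ℝ => -C * (t - a)) (-C) t := by
        simpa using ((hasDerivAt_id t).sub_const a).const_mul (-C)
      exact ((hf' t ht).mul hlin.exp).hasDerivWithinAt
    · intro t ht
      rw [interior_Icc] at ht
      nlinarith [hle t ht, exp_pos (-C * (t - a))]
  intro t ht
  have h1 := hanti (left_mem_Icc.2 (ht.1.trans ht.2)) ht ht.1
  simp only [sub_self, mul_zero, exp_zero, mul_one] at h1
  calc f t = f t * exp (-C * (t - a)) * exp (C * (t - a)) := by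
        rw [mul_assoc, ← exp_add]; simp
    _ ≤ f a * exp (C * (t - a)) := by gcongr

open Real in
lemma mul_exp_le_of_neg_mul_le_deriv {f f' : ℝ → ℝ} {a b C : ℝ} (hf : ContinuousOn f (Icc a b))
    (hf' : ∀ t ∈ Ioo a b, HasDerivAt f (f' t) t) (hle : ∀ t ∈ Ioo a b, -(C * f t) ≤ f' t)
    (hab : a ≤ b) : f a ≤ f b * exp (C * (b - a)) := by
  have hneg : ∀ t, HasDerivAt (fun t : ℝ => -t) (-1) t := fun t => hasDerivAt_neg t
  have key := le_mul_exp_of_deriv_le_mul (f := fun t => f (-t)) (f' := fun t => -f' (-t))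
    (a := -b) (b := -a) (C := C) ?_ ?_ ?_ (-a) (by constructor <;> linarith)
  · simpa [sub_eq_add_neg, add_comm] using key
  · refine hf.comp (by fun_prop) ?_
    intro t ht
    constructor <;> linarith [ht.1, ht.2]
  · intro t ht
    have := (hf' (-t) ⟨by linarith [ht.2], by linarith [ht.1]⟩).comp t (hneg t)
    exact this.congr_deriv (by simp)
  · intro t ht
    have := hle (-t) ⟨by linarith [ht.2], by linarith [ht.1]⟩
    linarith

/-- A polar angle of a phase curve `(u, u')` can cross `π / 2` only downwards. -/
lemma angle_lt_pi_div_two {u u' r θ : ℝ → ℝ} {T : ℝ}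
    (hu : ∀ t ∈ Icc 0 T, HasDerivWithinAt u (u' t) (Icc 0 T) t)
    (hθ : ContinuousOn θ (Icc 0 T)) (hθ0 : θ 0 = 0) (hr : ∀ t ∈ Icc 0 T, 0 < r t)
    (hcos : ∀ t ∈ Icc 0 T, u t = r t * Real.cos (θ t))
    (hsin : ∀ t ∈ Icc 0 T, u' t = r t * Real.sin (θ t)) :
    ∀ t ∈ Icc 0 T, θ t < Real.pi / 2 := by
  by_contra! hcon
  obtain ⟨t₁, ht₁, hθt₁⟩ := hcon
  have hcomp : IsCompact (Icc 0 T ∩ θ ⁻¹' Ici (Real.pi / 2)) :=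
    isCompact_Icc.of_isClosed_subset (hθ.preimage_isClosed_of_isClosed isClosed_Icc isClosed_Ici)
      inter_subset_left
  obtain ⟨s, ⟨hs, hθs⟩, hmin⟩ := hcomp.exists_isLeast ⟨t₁, ht₁, hθt₁⟩
  simp only [mem_preimage, mem_Ici] at hθs
  have hpi := Real.pi_pos
  have hs0 : 0 < s := by
    rcases hs.1.eq_or_lt with h0 | h0
    · rw [← h0, hθ0] at hθs; linarith
    · exact h0
  have hlt : ∀ t ∈ Ioo 0 s, θ t < Real.pi / 2 := by
    intro t ht
    by_contra! h1
    exact absurd (hmin ⟨⟨ht.1.le, ht.2.le.trans hs.2⟩, h1⟩) (not_le.2 ht.2)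
  have hnhds : Ioo 0 s ∈ nhdsWithin s (Iio s) := Ioo_mem_nhdsLT hs0
  have hsub : Ioo 0 s ⊆ Icc 0 T := fun t ht => ⟨ht.1.le, ht.2.le.trans hs.2⟩
  have hle : nhdsWithin s (Iio s) ≤ nhdsWithin s (Icc 0 T) :=
    nhdsWithin_le_iff.2 (mem_of_superset hnhds hsub)
  have htend : Tendsto θ (nhdsWithin s (Iio s)) (nhds (θ s)) := (hθ s hs).mono_left hle
  have hθs' : θ s = Real.pi / 2 :=
    le_antisymm (le_of_tendsto htend (mem_of_superset hnhds fun t ht => (hlt t ht).le)) hθs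
  have hus : u s = 0 := by rw [hcos s hs, hθs', Real.cos_pi_div_two, mul_zero]
  have hus' : 0 < u' s := by
    rw [hsin s hs, hθs', Real.sin_pi_div_two, mul_one]; exact hr s hs
  have hder : HasDerivWithinAt u (u' s) (Iio s) s :=
    (hu s hs).mono_of_mem_nhdsWithin (mem_of_superset hnhds hsub)
  rw [hasDerivWithinAt_iff_tendsto_slope' (by simp)] at hder
  have h1 := hder.eventually (lt_mem_nhds hus')
  have h2 := htend.eventually (lt_mem_nhds (show 0 < θ s by linarith))
  obtain ⟨t, ⟨h1, h2⟩, ht⟩ := ((h1.and h2).and hnhds).exists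
  have hut : 0 < u t := by
    rw [hcos t (hsub ht)]
    exact mul_pos (hr t (hsub ht)) (Real.cos_pos_of_mem_Ioo ⟨by linarith, hlt t ht⟩)
  rw [slope_def_field, hus, sub_zero] at h1
  exact absurd h1 (not_lt.2 (div_nonpos_of_nonneg_of_nonpos hut.le (by linarith [ht.2])))

/-- The nonlinearity is Lipschitz on bounded intervals. -/
lemma exists_abs_sub_le_mul_abs_sub {lam q : ℝ} (hlam : 0 < lam) (hq : 1 < q) (R : ℝ) :
    ∃ L, 0 ≤ L ∧ ∀ x y : ℝ, |x| ≤ R → |y| ≤ R →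
      |lam * (|x| ^ (q - 1) * x - x) - lam * (|y| ^ (q - 1) * y - y)| ≤ L * |x - y| := by
  by_cases hR : 0 ≤ R
  swap
  · exact ⟨0, le_rfl, fun x _ hx => absurd ((abs_nonneg x).trans hx) hR⟩
  have hpow : ∀ x ∈ Icc 0 R, ∀ y ∈ Icc 0 R, |x ^ q - y ^ q| ≤ q * R ^ (q - 1) * |x - y| := by
    intro x hx y hy
    have := Convex.norm_image_sub_le_of_norm_hasDerivWithin_le
      (f := fun x : ℝ => x ^ q) (f' := fun x => q * x ^ (q - 1)) (C := q * R ^ (q - 1))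
      (fun z _ => (Real.hasDerivAt_rpow_const (Or.inr hq.le)).hasDerivWithinAt)
      (fun z hz => by
        rw [Real.norm_of_nonneg (mul_nonneg (by linarith) (Real.rpow_nonneg hz.1 _))]
        exact mul_le_mul_of_nonneg_left
          (Real.rpow_le_rpow hz.1 hz.2 (by linarith)) (by linarith)) (convex_Icc 0 R) hy hx
    simpa [Real.norm_eq_abs] using this
  have hform : ∀ x : ℝ, |x| ^ (q - 1) * x = (max x 0) ^ q - (max (-x) 0) ^ q := by
    intro x
    have hq0 : q ≠ 0 := by linarith
    have hmul : ∀ z : ℝ, 0 ≤ z → z ^ (q - 1) * z = z ^ q := by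
      intro z hz
      rw [← Real.rpow_add_one' hz (by linarith), sub_add_cancel]
    rcases le_total 0 x with hx | hx
    · rw [abs_of_nonneg hx, max_eq_left hx, max_eq_right (by linarith), Real.zero_rpow hq0,
        hmul x hx, sub_zero]
    · rw [abs_of_nonpos hx, max_eq_right hx, max_eq_left (by linarith), Real.zero_rpow hq0]
      linarith [hmul (-x) (by linarith)]
  have hM : 0 ≤ q * R ^ (q - 1) := mul_nonneg (by linarith) (Real.rpow_nonneg hR _)
  refine ⟨lam * (2 * (q * R ^ (q - 1)) + 1), by positivity, fun x y hx hy => ?_⟩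
  rw [abs_le] at hx hy
  have h1 := hpow (max x 0) ⟨le_max_right _ _, max_le hx.2 hR⟩
    (max y 0) ⟨le_max_right _ _, max_le hy.2 hR⟩
  have h2 := hpow (max (-x) 0) ⟨le_max_right _ _, max_le (by linarith) hR⟩
    (max (-y) 0) ⟨le_max_right _ _, max_le (by linarith) hR⟩
  have h3 : |max x 0 - max y 0| ≤ |x - y| := abs_max_sub_max_le_abs x y 0
  have h4 : |max (-x) 0 - max (-y) 0| ≤ |x - y| := by
    have := abs_max_sub_max_le_abs (-x) (-y) 0
    rwa [show -x - -y = -(x - y) by ring, abs_neg] at this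
  rw [← mul_sub, abs_mul, abs_of_pos hlam, mul_assoc]
  refine mul_le_mul_of_nonneg_left ?_ hlam.le
  rw [hform x, hform y]
  calc |max x 0 ^ q - max (-x) 0 ^ q - x - (max y 0 ^ q - max (-y) 0 ^ q - y)|
      = |(max x 0 ^ q - max y 0 ^ q) - (max (-x) 0 ^ q - max (-y) 0 ^ q) - (x - y)| := by
        congr 1; ring
    _ ≤ |max x 0 ^ q - max y 0 ^ q| + |max (-x) 0 ^ q - max (-y) 0 ^ q| + |x - y| :=
        (abs_sub _ _).trans (by gcongr; exact abs_sub _ _)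
    _ ≤ q * R ^ (q - 1) * |x - y| + q * R ^ (q - 1) * |x - y| + |x - y| := by
        gcongr
        · exact h1.trans (mul_le_mul_of_nonneg_left h3 hM)
        · exact h2.trans (mul_le_mul_of_nonneg_left h4 hM)
    _ = (2 * (q * R ^ (q - 1)) + 1) * |x - y| := by ring

/-- Sublevel sets of the potential energy are bounded. -/
lemma exists_abs_le_of_potential_le {q : ℝ} (hq : 1 < q) (C : ℝ) :
    ∃ R, ∀ x : ℝ, |x| ^ (q + 1) / (q + 1) - x ^ 2 / 2 ≤ C → |x| ≤ R := by
  have htop := tendsto_rpow_atTop (show 0 < q - 1 by linarith)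
  obtain ⟨R, hR⟩ := eventually_atTop.1
    ((htop.eventually_ge_atTop ((q + 1) * (1 + |C|))).and (eventually_ge_atTop (1 : ℝ)))
  refine ⟨R, fun x hx => ?_⟩
  by_contra! hlt
  obtain ⟨h1, h2⟩ := hR |x| hlt.le
  have hpow : |x| ^ (q + 1) = |x| ^ (q - 1) * x ^ 2 := by
    rw [← sq_abs x, ← Real.rpow_natCast |x| 2, ← Real.rpow_add (by linarith)]
    congr 1; push_cast; ring
  have hx2 : 1 ≤ x ^ 2 := by rw [← sq_abs x]; nlinarith
  have h3 : 1 + |C| ≤ |x| ^ (q - 1) / (q + 1) := by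
    rw [le_div_iff₀ (by linarith)]; linarith
  rw [hpow, mul_div_right_comm] at hx
  nlinarith [le_abs_self C, abs_nonneg C]

section Solution

variable {h : ℝ → ℝ} {lam q T : ℝ} {u u' u'' v v' v'' : ℝ → ℝ}

lemma SolOn.continuousOn {S Sint : Set ℝ} (hs : SolOn h lam q S Sint u u' u'') :
    ContinuousOn u S :=
  fun t ht => (hs.1 t ht).continuousWithinAt

lemma SolOn.hasDerivAt (hs : SolOn h lam q (Icc 0 T) (Ioc 0 T) u u' u'') {t : ℝ}
    (ht : t ∈ Ioo 0 T) : HasDerivAt u (u' t) t :=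
  (hs.1 t ⟨ht.1.le, ht.2.le⟩).hasDerivAt (Icc_mem_nhds ht.1 ht.2)

lemma SolOn.hasDerivAt_deriv (hs : SolOn h lam q (Icc 0 T) (Ioc 0 T) u u' u'') {t : ℝ}
    (ht : t ∈ Ioo 0 T) :
    HasDerivAt u' (-(h t * u' t) - lam * (|u t| ^ (q - 1) * u t - u t)) t := by
  have hmem : t ∈ Ioc 0 T := ⟨ht.1, ht.2.le⟩
  have h1 := (hs.2.2.1 t hmem).hasDerivAt (Ioc_mem_nhds ht.1 ht.2)
  exact h1.congr_deriv (by linarith [hs.2.2.2.2 t hmem])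

/-- The energy of a solution does not exceed its initial value. -/
lemma SolOn.potential_le (hlam : 0 < lam) (hq : 1 < q)
    (hs : SolOn h lam q (Icc 0 T) (Ioc 0 T) u u' u'') (hh : ∀ t ∈ Ioo 0 T, 0 < h t)
    (h0 : u' 0 = 0) {t : ℝ} (ht : t ∈ Icc 0 T) :
    |u t| ^ (q + 1) / (q + 1) - u t ^ 2 / 2 ≤ |u 0| ^ (q + 1) / (q + 1) - u 0 ^ 2 / 2 := by
  have hu := hs.continuousOn
  have hu' := hs.2.1
  have hanti : AntitoneOn
      (fun t => u' t ^ 2 / 2 + lam * (|u t| ^ (q + 1) / (q + 1) - u t ^ 2 / 2)) (Icc 0 T) := by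
    refine antitoneOn_of_hasDerivWithinAt_nonpos (convex_Icc 0 T)
      (f' := fun t => -(h t * u' t ^ 2)) ?_ ?_ ?_
    · have h1 : ContinuousOn (fun t => |u t| ^ (q + 1)) (Icc 0 T) :=
        hu.abs.rpow_const fun _ _ => Or.inr (by linarith)
      fun_prop
    · intro t ht
      rw [interior_Icc] at ht
      have h1 := hs.hasDerivAt ht
      have h2 := hs.hasDerivAt_deriv ht
      have h3 := (hasDerivAt_abs_rpow (u t) (show 1 < q + 1 by linarith)).comp t h1
      have h4 := ((h2.pow 2).div_const 2).add
        (((h3.div_const (q + 1)).sub ((h1.pow 2).div_const 2)).const_mul lam)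
      refine (h4.congr_deriv ?_).hasDerivWithinAt
      rw [show q + 1 - 2 = q - 1 by ring]
      have : q + 1 ≠ 0 := by linarith
      field_simp
      push_cast
      ring
    · intro t ht
      rw [interior_Icc] at ht
      nlinarith [hh t ht, sq_nonneg (u' t), mul_nonneg (hh t ht).le (sq_nonneg (u' t))]
  have h1 := hanti (left_mem_Icc.2 (ht.1.trans ht.2)) ht ht.1
  simp only [h0] at h1
  have h2 : lam * (|u t| ^ (q + 1) / (q + 1) - u t ^ 2 / 2) ≤
      lam * (|u 0| ^ (q + 1) / (q + 1) - u 0 ^ 2 / 2) := by nlinarith [sq_nonneg (u' t)]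
  exact le_of_mul_le_mul_left h2 hlam

/-- Continuous dependence on the initial data: damping makes the singularity harmless. -/
lemma SolOn.sq_sub_add_sq_sub_le {R L : ℝ} (hL : 0 ≤ L)
    (hLip : ∀ x y : ℝ, |x| ≤ R → |y| ≤ R →
      |lam * (|x| ^ (q - 1) * x - x) - lam * (|y| ^ (q - 1) * y - y)| ≤ L * |x - y|)
    (hs : SolOn h lam q (Icc 0 T) (Ioc 0 T) u u' u'')
    (hs' : SolOn h lam q (Icc 0 T) (Ioc 0 T) v v' v'') (hh : ∀ t ∈ Ioo 0 T, 0 < h t)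
    (huR : ∀ t ∈ Icc 0 T, |u t| ≤ R) (hvR : ∀ t ∈ Icc 0 T, |v t| ≤ R)
    {t : ℝ} (ht : t ∈ Icc 0 T) :
    (u t - v t) ^ 2 + (u' t - v' t) ^ 2 ≤
      ((u 0 - v 0) ^ 2 + (u' 0 - v' 0) ^ 2) * Real.exp ((1 + L) * T) := by
  have hu := hs.continuousOn
  have hu' := hs.2.1
  have hv := hs'.continuousOn
  have hv' := hs'.2.1
  have key := le_mul_exp_of_deriv_le_mul (a := 0) (b := T) (C := 1 + L)
    (f := fun t => (u t - v t) ^ 2 + (u' t - v' t) ^ 2)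
    (f' := fun t => 2 * (u t - v t) * (u' t - v' t) + 2 * (u' t - v' t) *
      ((-(h t * u' t) - lam * (|u t| ^ (q - 1) * u t - u t)) -
        (-(h t * v' t) - lam * (|v t| ^ (q - 1) * v t - v t)))) (by fun_prop) ?_ ?_ t ht
  · rw [sub_zero] at key
    refine key.trans (mul_le_mul_of_nonneg_left ?_ (by positivity))
    exact Real.exp_le_exp.2 (mul_le_mul_of_nonneg_left ht.2 (by linarith))
  · intro t ht
    have h1 := ((hs.hasDerivAt ht).sub (hs'.hasDerivAt ht)).pow 2
    have h2 := ((hs.hasDerivAt_deriv ht).sub (hs'.hasDerivAt_deriv ht)).pow 2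
    refine (h1.add h2).congr_deriv ?_
    simp
  · intro t ht
    have htc : t ∈ Icc 0 T := ⟨ht.1.le, ht.2.le⟩
    have h1 := hLip _ _ (huR t htc) (hvR t htc)
    set D := lam * (|u t| ^ (q - 1) * u t - u t) - lam * (|v t| ^ (q - 1) * v t - v t) with hD
    have h2 : -((u' t - v' t) * D) ≤ |u' t - v' t| * (L * |u t - v t|) := by
      refine (neg_le_abs _).trans ?_
      rw [abs_mul]
      gcongr
    have h3 : (u t - v t) * (u' t - v' t) ≤ |u t - v t| * |u' t - v' t| := by
      rw [← abs_mul]; exact le_abs_self _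
    have h4 : 2 * (|u t - v t| * |u' t - v' t|) ≤ (u t - v t) ^ 2 + (u' t - v' t) ^ 2 := by
      rw [← sq_abs (u t - v t), ← sq_abs (u' t - v' t)]
      nlinarith [sq_nonneg (|u t - v t| - |u' t - v' t|)]
    have h5 : 0 ≤ h t * (u' t - v' t) ^ 2 := mul_nonneg (hh t ht).le (sq_nonneg _)
    have h6 := mul_le_mul_of_nonneg_left h4 hL
    rw [show 2 * (u t - v t) * (u' t - v' t) + 2 * (u' t - v' t) *
      ((-(h t * u' t) - lam * (|u t| ^ (q - 1) * u t - u t)) -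
        (-(h t * v' t) - lam * (|v t| ^ (q - 1) * v t - v t))) =
      2 * ((u t - v t) * (u' t - v' t)) - 2 * (h t * (u' t - v' t) ^ 2)
        + 2 * (-((u' t - v' t) * D)) by rw [hD]; ring]
    nlinarith

/-- A solution with nonzero initial value never reaches the origin of the phase plane. -/
lemma SolOn.ne_zero_or_ne_zero (hlam : 0 < lam) (hq : 1 < q)
    (hs : SolOn h lam q (Icc 0 T) (Ioc 0 T) u u' u'') (hc : ContinuousOn h (Ioc 0 T))
    (h0 : u 0 ≠ 0) {t : ℝ} (ht : t ∈ Icc 0 T) : u t ≠ 0 ∨ u' t ≠ 0 := by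
  by_contra! hcon
  obtain ⟨hut, hut'⟩ := hcon
  have htpos : 0 < t := by
    rcases ht.1.eq_or_lt with h1 | h1
    · rw [← h1] at hut; exact absurd hut h0
    · exact h1
  have hu := hs.continuousOn
  have hu' := hs.2.1
  obtain ⟨R, hR⟩ := isCompact_Icc.exists_bound_of_continuousOn hu
  obtain ⟨L, hL, hLip⟩ := exists_abs_sub_le_mul_abs_sub hlam hq R
  have hzero : ∀ s ∈ Ioo 0 t, u s = 0 := by
    intro s hst
    have hsub : Icc s t ⊆ Icc 0 T := Icc_subset_Icc hst.1.le ht.2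
    obtain ⟨H, hH⟩ := isCompact_Icc.exists_bound_of_continuousOn
      (hc.mono (fun x hx => ⟨hst.1.trans_le hx.1, hx.2.trans ht.2⟩ : Icc s t ⊆ Ioc 0 T))
    have hH0 : 0 ≤ H := (norm_nonneg _).trans (hH s (left_mem_Icc.2 hst.2.le))
    have key := mul_exp_le_of_neg_mul_le_deriv (a := s) (b := t) (C := 1 + L + 2 * H)
      (f := fun t => u t ^ 2 + u' t ^ 2)
      (f' := fun t => 2 * u t * u' t + 2 * u' t *
        (-(h t * u' t) - lam * (|u t| ^ (q - 1) * u t - u t)))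
      (((hu.mono hsub).pow 2).add ((hu'.mono hsub).pow 2)) ?_ ?_ hst.2.le
    · simp only [hut, hut'] at key
      nlinarith [sq_nonneg (u s), sq_nonneg (u' s)]
    · intro x hx
      have hx' : x ∈ Ioo 0 T := ⟨hst.1.trans hx.1, hx.2.trans_le ht.2⟩
      refine (((hs.hasDerivAt hx').pow 2).add ((hs.hasDerivAt_deriv hx').pow 2)).congr_deriv ?_
      simp
    · intro x hx
      have hxR := hR x (hsub ⟨hx.1.le, hx.2.le⟩)
      have h1 := hLip (u x) 0 hxR (by simpa using (norm_nonneg _).trans hxR)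
      simp only [mul_zero, sub_zero] at h1
      have h2 := hH x ⟨hx.1.le, hx.2.le⟩
      rw [Real.norm_eq_abs] at h2
      set D := lam * (|u x| ^ (q - 1) * u x - u x) with hD
      have h3 : u' x * D ≤ |u' x| * (L * |u x|) := by
        refine (le_abs_self _).trans ?_
        rw [abs_mul]
        gcongr
      have h4 : -(u x * u' x) ≤ |u x| * |u' x| := by
        rw [← abs_mul]; exact neg_le_abs _
      have h5 : 2 * (|u x| * |u' x|) ≤ u x ^ 2 + u' x ^ 2 := by
        rw [← sq_abs (u x), ← sq_abs (u' x)]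
        nlinarith [sq_nonneg (|u x| - |u' x|)]
      have h6 := mul_le_mul_of_nonneg_left h5 hL
      have h7 : h x * u' x ^ 2 ≤ H * u' x ^ 2 :=
        mul_le_mul_of_nonneg_right ((le_abs_self _).trans h2) (sq_nonneg _)
      have h8 : 0 ≤ H * u x ^ 2 := by positivity
      nlinarith
  have hlim : Tendsto u (nhdsWithin 0 (Ioi 0)) (nhds (u 0)) :=
    (hu 0 (left_mem_Icc.2 (ht.1.trans ht.2))).mono_left
      (nhdsWithin_le_iff.2 (mem_of_superset (Ioo_mem_nhdsGT htpos)
        fun x hx => ⟨hx.1.le, hx.2.le.trans ht.2⟩))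
  refine h0 (tendsto_nhds_unique hlim (tendsto_const_nhds.congr' ?_))
  filter_upwards [Ioo_mem_nhdsGT htpos] with s hst
  exact (hzero s hst).symm

end Solution

/-- A continuous nonvanishing planar map on a rectangle has a continuous polar angle. -/
lemma exists_continuousOn_polar {x y : ℝ → ℝ → ℝ} {a b c d : ℝ} (hab : a ≤ b) (hcd : c ≤ d)
    (hx : ContinuousOn (fun p : ℝ × ℝ => x p.1 p.2) (Icc a b ×ˢ Icc c d))
    (hy : ContinuousOn (fun p : ℝ × ℝ => y p.1 p.2) (Icc a b ×ˢ Icc c d))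
    (hne : ∀ s ∈ Icc a b, ∀ t ∈ Icc c d, x s t ≠ 0 ∨ y s t ≠ 0)
    (hx0 : 0 < x a c) (hy0 : y a c = 0) :
    ∃ r θ : ℝ → ℝ → ℝ, ContinuousOn (fun p : ℝ × ℝ => θ p.1 p.2) (Icc a b ×ˢ Icc c d) ∧
      θ a c = 0 ∧ ∀ s ∈ Icc a b, ∀ t ∈ Icc c d, 0 < r s t ∧
        x s t = r s t * Real.cos (θ s t) ∧ y s t = r s t * Real.sin (θ s t) := by
  let P : ℝ × ℝ → ℝ × ℝ := fun p => (projIcc a b hab p.1, projIcc c d hcd p.2)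
  have hP : Continuous P := by
    have h1 : Continuous (projIcc a b hab) := continuous_projIcc
    have h2 : Continuous (projIcc c d hcd) := continuous_projIcc
    fun_prop
  have hPm : ∀ p, P p ∈ Icc a b ×ˢ Icc c d := fun p =>
    ⟨(projIcc a b hab p.1).2, (projIcc c d hcd p.2).2⟩
  have hPe : ∀ s ∈ Icc a b, ∀ t ∈ Icc c d, P (s, t) = (s, t) := by
    intro s hs t ht
    simp only [P, projIcc_of_mem hab hs, projIcc_of_mem hcd ht]
  let F : C(ℝ × ℝ, ℂ) := ⟨fun p => (x (P p).1 (P p).2 : ℂ) + (y (P p).1 (P p).2 : ℂ) * Complex.I, by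
    have h1 : Continuous fun p => x (P p).1 (P p).2 := hx.comp_continuous hP hPm
    have h2 : Continuous fun p => y (P p).1 (P p).2 := hy.comp_continuous hP hPm
    exact (Complex.continuous_ofReal.comp h1).add
      ((Complex.continuous_ofReal.comp h2).mul continuous_const)⟩
  have hF : ∀ s ∈ Icc a b, ∀ t ∈ Icc c d, F (s, t) = (x s t : ℂ) + (y s t : ℂ) * Complex.I := by
    intro s hs t ht
    simp only [F, ContinuousMap.coe_mk, hPe s hs t ht]
  have hF0 : ∀ p, F p ∈ ({0}ᶜ : Set ℂ) := by
    intro p h0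
    have hre := congrArg Complex.re h0
    have him := congrArg Complex.im h0
    simp [F] at hre him
    rcases hne _ (hPm p).1 _ (hPm p).2 with h1 | h1
    · exact h1 hre
    · exact h1 him
  have hstart : Complex.exp (Real.log (x a c) : ℝ) = F (a, c) := by
    rw [hF a (left_mem_Icc.2 hab) c (left_mem_Icc.2 hcd), hy0, ← Complex.ofReal_exp,
      Real.exp_log hx0]
    simp
  obtain ⟨G, ⟨hG0, hG⟩, -⟩ :=
    Complex.isCoveringMapOn_exp.existsUnique_continuousMap_lifts F hstart hF0
  refine ⟨fun s t => Real.exp (G (s, t)).re, fun s t => (G (s, t)).im,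
    (Complex.continuous_im.comp G.continuous).continuousOn, by simp [hG0], ?_⟩
  intro s hs t ht
  have h1 : Complex.exp (G (s, t)) = (x s t : ℂ) + (y s t : ℂ) * Complex.I := by
    rw [← hF s hs t ht, ← hG]; rfl
  have hre := congrArg Complex.re h1
  have him := congrArg Complex.im h1
  rw [Complex.exp_re] at hre
  rw [Complex.exp_im] at him
  simp at hre him
  exact ⟨Real.exp_pos _, hre.symm, him.symm⟩

lemma eq_zero_of_cos_eq_one {f : ℝ → ℝ} {a b : ℝ} (hf : ContinuousOn f (Icc a b))
    (ha : f a = 0) (hcos : ∀ t ∈ Icc a b, Real.cos (f t) = 1) : ∀ t ∈ Icc a b, f t = 0 := by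
  intro t ht
  by_contra hne
  have hpos : 0 < min |f t| Real.pi := lt_min (abs_pos.2 hne) Real.pi_pos
  have hsub : Icc a t ⊆ Icc a b := Icc_subset_Icc_right ht.2
  obtain ⟨s, hs, hfs⟩ := intermediate_value_Icc ht.1 (hf.mono hsub).abs
    (show min |f t| Real.pi ∈ Icc |f a| |f t| by
      rw [ha, abs_zero]; exact ⟨hpos.le, min_le_left _ _⟩)
  simp only at hfs
  have h1 : Real.cos |f s| = 1 := by rw [Real.cos_abs]; exact hcos s (hsub hs)
  have h2 : |f s| ≤ Real.pi := hfs ▸ min_le_right _ _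
  rw [Real.cos_eq_one_iff_of_lt_of_lt (by linarith [abs_nonneg (f s), Real.pi_pos])
    (by linarith [Real.pi_pos])] at h1
  linarith

lemma cos_sub_eq_one_of_polar_eq {x y r s θ φ : ℝ} (hr : 0 < r) (hs : 0 ≤ s)
    (hx : x = r * Real.cos θ) (hy : y = r * Real.sin θ)
    (hx' : x = s * Real.cos φ) (hy' : y = s * Real.sin φ) : Real.cos (θ - φ) = 1 := by
  have hr2 : x ^ 2 + y ^ 2 = r ^ 2 := by
    rw [hx, hy]; linear_combination r ^ 2 * Real.cos_sq_add_sin_sq θ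
  have hs2 : x ^ 2 + y ^ 2 = s ^ 2 := by
    rw [hx', hy']; linear_combination s ^ 2 * Real.cos_sq_add_sin_sq φ
  have hrs : r = s := (sq_eq_sq₀ hr.le hs).1 (hr2.symm.trans hs2)
  subst hrs
  rw [Real.cos_sub, ← mul_left_cancel₀ hr.ne' (hx.symm.trans hx'),
    ← mul_left_cancel₀ hr.ne' (hy.symm.trans hy')]
  linear_combination Real.cos_sq_add_sin_sq θ

theorem stmt_11
    (d lam : ℝ) (hd : 0 < d) (hlam : 0 < lam)
    (n m₁ m₂ : ℤ) (hn : 3 ≤ n)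
    (hm₁0 : 0 ≤ m₁) (hm₁n : m₁ ≤ n - 2) (hm₂0 : 0 ≤ m₂) (hm₂n : m₂ ≤ n - 2)
    (h : ℝ → ℝ) (hC1 : ContDiffOn ℝ 1 h (Set.Ioo 0 d))
    (hder : ∀ t ∈ Set.Ioo 0 d, deriv h t < 0)
    (hlim0 : Filter.Tendsto (fun t => t * h t) (nhdsWithin 0 (Set.Ioi 0))
      (nhds ((n : ℝ) - (m₁ : ℝ) - 1)))
    (hlimd : Filter.Tendsto (fun t => (t - d) * h t) (nhdsWithin d (Set.Iio d))
      (nhds ((n : ℝ) - (m₂ : ℝ) - 1)))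
    (q : ℝ) (hq1 : 1 < q)
    (t₀ : ℝ) (ht₀ : t₀ ∈ Set.Ioo 0 d)
    (hpos : ∀ t ∈ Set.Ioo 0 t₀, 0 < h t) (hneg : ∀ t ∈ Set.Ioo t₀ d, h t < 0)
    (U U' U'' : ℝ → ℝ → ℝ)
    (hU : ∀ α : ℝ, SolOn h lam q (Set.Icc 0 t₀) (Set.Ioc 0 t₀) (U α) (U' α) (U'' α) ∧
      U α 0 = α ∧ U' α 0 = 0)
    (hUuniq : ∀ α : ℝ, ∀ u u' u'' : ℝ → ℝ,
      SolOn h lam q (Set.Icc 0 t₀) (Set.Ioc 0 t₀) u u' u'' → u 0 = α → u' 0 = 0 →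
      ∀ t ∈ Set.Icc 0 t₀, u t = U α t ∧ u' t = U' α t)
    (a : ℝ → ℝ) (haCont : ContinuousOn a (Set.Ioi 0)) (ha1 : a 1 = 0)
    (haAngle : ∀ α : ℝ, 0 < α →
      U α t₀ = enorm2 (U α t₀, U' α t₀) * Real.cos (a α) ∧
      U' α t₀ = enorm2 (U α t₀, U' α t₀) * Real.sin (a α))
    :
    ∀ α : ℝ, 1 < α → a α < Real.pi / 2 := by
  intro A hA
  obtain ⟨ht₀0, ht₀d⟩ := ht₀
  have hc : ContinuousOn h (Ioc 0 t₀) :=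
    hC1.continuousOn.mono fun t ht => ⟨ht.1, ht.2.trans_lt ht₀d⟩
  have hL0 : (0 : ℝ) ∈ Icc 0 t₀ := left_mem_Icc.2 ht₀0.le
  have hRt : t₀ ∈ Icc 0 t₀ := right_mem_Icc.2 ht₀0.le
  have h1A : (1 : ℝ) ∈ Icc 1 A := left_mem_Icc.2 hA.le
  obtain ⟨R, hR⟩ := exists_abs_le_of_potential_le hq1 (A ^ (q + 1) / (q + 1))
  have hbound : ∀ α ∈ Icc 1 A, ∀ t ∈ Icc 0 t₀, |U α t| ≤ R := by
    intro α hα t ht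
    obtain ⟨hs, hs0, hs0'⟩ := hU α
    refine hR _ ((hs.potential_le hlam hq1 hpos hs0' ht).trans ?_)
    rw [hs0, abs_of_pos (by linarith [hα.1])]
    have h1 : α ^ (q + 1) ≤ A ^ (q + 1) :=
      Real.rpow_le_rpow (by linarith [hα.1]) hα.2 (by linarith)
    have h2 : α ^ (q + 1) / (q + 1) ≤ A ^ (q + 1) / (q + 1) :=
      div_le_div_of_nonneg_right h1 (by linarith)
    linarith [sq_nonneg α]
  obtain ⟨L, hL, hLip⟩ := exists_abs_sub_le_mul_abs_sub hlam hq1 R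
  set K := Real.exp ((1 + L) * t₀) with hK
  have hK1 : 1 ≤ K := Real.one_le_exp (by positivity)
  have hdep : ∀ t ∈ Icc 0 t₀, ∀ α ∈ Icc 1 A, ∀ β ∈ Icc 1 A,
      (U α t - U β t) ^ 2 + (U' α t - U' β t) ^ 2 ≤ (K * (α - β)) ^ 2 := by
    intro t ht α hα β hβ
    have h1 := (hU α).1.sq_sub_add_sq_sub_le hL hLip (hU β).1 hpos (hbound α hα) (hbound β hβ) ht
    rw [(hU α).2.1, (hU α).2.2, (hU β).2.1, (hU β).2.2, ← hK] at h1
    nlinarith [mul_le_mul_of_nonneg_left hK1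
      (mul_nonneg (sq_nonneg (α - β)) (by linarith : (0 : ℝ) ≤ K))]
  have hlipOf : ∀ f : ℝ → ℝ,
      (∀ α ∈ Icc 1 A, ∀ β ∈ Icc 1 A, (f α - f β) ^ 2 ≤ (K * (α - β)) ^ 2) →
      LipschitzOnWith K.toNNReal f (Icc 1 A) := by
    intro f hf
    refine LipschitzOnWith.of_dist_le_mul fun α hα β hβ => ?_
    have h1 := sq_le_sq.1 (hf α hα β hβ)
    rwa [abs_mul, abs_of_pos (by linarith : 0 < K), ← Real.dist_eq, ← Real.dist_eq,
      ← Real.coe_toNNReal K (by linarith)] at h1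
  have hcontU : ContinuousOn (fun p : ℝ × ℝ => U p.1 p.2) (Icc 1 A ×ˢ Icc 0 t₀) :=
    continuousOn_prod_of_continuousOn_lipschitzOnWith _ K.toNNReal
      (fun α _ => (hU α).1.continuousOn) fun t ht => hlipOf _ fun α hα β hβ => by
        linarith [hdep t ht α hα β hβ, sq_nonneg (U' α t - U' β t)]
  have hcontU' : ContinuousOn (fun p : ℝ × ℝ => U' p.1 p.2) (Icc 1 A ×ˢ Icc 0 t₀) :=
    continuousOn_prod_of_continuousOn_lipschitzOnWith _ K.toNNReal
      (fun α _ => (hU α).1.2.1) fun t ht => hlipOf _ fun α hα β hβ => by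
        linarith [hdep t ht α hα β hβ, sq_nonneg (U α t - U β t)]
  obtain ⟨r, θ, hθc, hθ0, hpolar⟩ := exists_continuousOn_polar hA.le ht₀0.le hcontU hcontU'
    (fun α hα t ht => (hU α).1.ne_zero_or_ne_zero hlam hq1 hc
      (by rw [(hU α).2.1]; linarith [hα.1]) ht)
    (by rw [(hU 1).2.1]; exact one_pos) (hU 1).2.2
  have hθt : ∀ α ∈ Icc 1 A, ContinuousOn (θ α) (Icc 0 t₀) := fun α hα =>
    hθc.comp (f := fun t => (α, t)) (by fun_prop) fun t ht => ⟨hα, ht⟩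
  have hθα : ∀ t ∈ Icc 0 t₀, ContinuousOn (fun α => θ α t) (Icc 1 A) := fun t ht =>
    hθc.comp (f := fun α => (α, t)) (by fun_prop) fun α hα => ⟨hα, ht⟩
  have hcos : ∀ α ∈ Icc 1 A, ∀ t ∈ Icc 0 t₀, 0 < U α t → U' α t = 0 → Real.cos (θ α t) = 1 := by
    intro α hα t ht h1 h2
    obtain ⟨hr, hx, hy⟩ := hpolar α hα t ht
    simpa using cos_sub_eq_one_of_polar_eq (φ := 0) hr h1.le hx hy (by simp) (by simp [h2])
  have hone : ∀ t ∈ Icc 0 t₀, 1 = U 1 t ∧ 0 = U' 1 t :=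
    hUuniq 1 (fun _ => 1) (fun _ => 0) (fun _ => 0)
      ⟨fun t _ => hasDerivWithinAt_const _ _ _, continuousOn_const,
        fun t _ => hasDerivWithinAt_const _ _ _, continuousOn_const, fun t _ => by simp⟩ rfl rfl
  have hθ1 : ∀ t ∈ Icc 0 t₀, θ 1 t = 0 :=
    eq_zero_of_cos_eq_one (hθt 1 h1A) hθ0 fun t ht =>
      hcos 1 h1A t ht ((hone t ht).1 ▸ one_pos) (hone t ht).2.symm
  have hθstart : ∀ α ∈ Icc 1 A, θ α 0 = 0 :=
    eq_zero_of_cos_eq_one (hθα 0 hL0) hθ0 fun α hα =>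
      hcos α hα 0 hL0 (by rw [(hU α).2.1]; linarith [hα.1]) (hU α).2.2
  have hdiff : ∀ α ∈ Icc 1 A, θ α t₀ - a α = 0 :=
    eq_zero_of_cos_eq_one
      ((hθα t₀ hRt).sub (haCont.mono fun α hα => one_pos.trans_le hα.1))
      (by simp only [hθ1 t₀ hRt, ha1, sub_zero]) fun α hα => by
        obtain ⟨hr, hx, hy⟩ := hpolar α hα t₀ hRt
        obtain ⟨hx', hy'⟩ := haAngle α (one_pos.trans_le hα.1)
        exact cos_sub_eq_one_of_polar_eq hr (Real.sqrt_nonneg _) hx hy hx' hy'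
  have hAA : A ∈ Icc 1 A := right_mem_Icc.2 hA.le
  rw [← sub_eq_zero.1 (hdiff A hAA)]
  exact angle_lt_pi_div_two (hU A).1.1 (hθt A hAA) (hθstart A hAA)
    (fun t ht => (hpolar A hAA t ht).1) (fun t ht => (hpolar A hAA t ht).2.1)
    (fun t ht => (hpolar A hAA t ht).2.2) t₀ hRt
end
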